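/- arXiv:0903.3675 — 2 statements merged into one kernel-verified Lean document; each statement's English description precedes it below -/
import Mathlib

section
/- Let k be a field of characteristic 2. For every positive integer m, the permutation k Sym(2m)-module kΞ_{2m} admits no projective indecomposable direct summand. -/
/-! Basic notions: direct summands, indecomposable modules, permutation modules,
relative projectivity, vertices, and fixed point sets of components, following
Broué and the paper. -/

open scoped Pointwise

namespace PPaper

universe u v

/-- `M` is (isomorphic to) a direct summand of `N` as `A`-modules. -/
def IsSummand (A : Type*) [Ring A] (M : Type*) [AddCommGroup M] [Module A M]
    (N : Type*) [AddCommGroup N] [Module A N] : Prop :=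
  ∃ (i : M →ₗ[A] N) (p : N →ₗ[A] M), p.comp i = LinearMap.id

/-- `M` is an indecomposable `A`-module: it is nonzero, and its only idempotent
endomorphisms are `0` and the identity. -/
def IsIndecomposable (A : Type*) [Ring A] (M : Type*) [AddCommGroup M] [Module A M] : Prop :=
  Nontrivial M ∧ ∀ e : M →ₗ[A] M, e.comp e = e → e = 0 ∨ e = LinearMap.id

/-- The permutation module `RΩ` of a `G`-set `Ω`, as a module over the group algebra. -/
noncomputable abbrev PermMod (R : Type u) [CommRing R] (G : Type u) [Group G]
    (Ω : Type u) [MulAction G Ω] : Type u :=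
  (Representation.ofMulAction R G Ω).asModule

/-- The ring homomorphism `R[H] → R[G]` induced by a group homomorphism `H → G`. -/
noncomputable def grpRingHom (R : Type u) [CommRing R] {H G : Type u} [Group H] [Group G]
    (f : H →* G) : MonoidAlgebra R H →+* MonoidAlgebra R G :=
  MonoidAlgebra.mapDomainRingHom R f

/-- The module induced from a module `L` for a subgroup `H ≤ G` (realised, as is
legitimate for finite groups, by the coinduced module `Hom_{R[H]}(R[G], L)`). -/
noncomputable def IndMod {R : Type u} [CommRing R] {G : Type u} [Group G] (H : Subgroup G)
    (L : ModuleCat.{u} (MonoidAlgebra R H)) : ModuleCat.{u} (MonoidAlgebra R G) :=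
  (ModuleCat.coextendScalars (grpRingHom R H.subtype)).obj L

/-- A module `M` for `G` over `R` is relatively `H`-projective if it is a direct summand
of a module induced from `H`. -/
def IsRelProjective (R : Type u) [CommRing R] {G : Type u} [Group G]
    (M : Type u) [AddCommGroup M] [Module (MonoidAlgebra R G) M] (H : Subgroup G) : Prop :=
  ∃ L : ModuleCat.{u} (MonoidAlgebra R H), IsSummand (MonoidAlgebra R G) M (IndMod H L)

/-- A vertex of `M`: a subgroup `Q ≤ G` minimal subject to the condition that `M` is a
direct summand of a module induced from `Q`. -/
def IsVertex (R : Type u) [CommRing R] {G : Type u} [Group G]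
    (M : Type u) [AddCommGroup M] [Module (MonoidAlgebra R G) M] (Q : Subgroup G) : Prop :=
  IsRelProjective R M Q ∧ ∀ Q' ≤ Q, IsRelProjective R M Q' → Q' = Q

/-- The fixed points of a subgroup `Q ≤ G` on a `G`-set `Ω`. -/
def FixSet {G : Type u} [Group G] (Ω : Type u) [MulAction G Ω] (Q : Subgroup G) : Set Ω :=
  {ω : Ω | ∀ g ∈ Q, g • ω = ω}

/-- `X ⊆ Ω` is a fixed point set (for the permutation module `kΩ`) if `X = Fix_Ω(Q)`
where `Q` is a vertex of some indecomposable direct summand of `kΩ`. -/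
def IsFixedPointSet (k : Type u) [Field k] (G : Type u) [Group G]
    (Ω : Type u) [MulAction G Ω] (X : Set Ω) : Prop :=
  ∃ (M : ModuleCat.{u} (MonoidAlgebra k G)) (Q : Subgroup G),
    IsSummand (MonoidAlgebra k G) M (PermMod k G Ω) ∧
    IsIndecomposable (MonoidAlgebra k G) M ∧
    IsVertex k M Q ∧ X = FixSet Ω Q

end PPaper
namespace PPaper

/-- The symmetric group on `n` letters. -/
abbrev Sym (n : ℕ) := Equiv.Perm (Fin n)

/-- The set `Ξ_m` of fixed-point-free involutions in `Sym m`. -/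
def XiSet (m : ℕ) : Set (Sym m) := {g | g * g = 1 ∧ ∀ x, g x ≠ x}

/-- `Sym m` acts on `Ξ_m` by conjugation. -/
noncomputable instance xiAction (m : ℕ) : MulAction (Sym m) ↥(XiSet m) where
  smul g x := ⟨g * x.1 * g⁻¹, by
    obtain ⟨hx1, hx2⟩ := x.2
    refine ⟨by
      have h : g * x.1 * g⁻¹ * (g * x.1 * g⁻¹) = g * (x.1 * x.1) * g⁻¹ := by group
      rw [h, hx1]; group, ?_⟩
    intro a ha
    exact hx2 (g⁻¹ a) (by
      have := congrArg (⇑g⁻¹) ha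
      simpa [Equiv.Perm.mul_apply] using this)⟩
  one_smul x := Subtype.ext (show (1 : Sym m) * x.1 * (1 : Sym m)⁻¹ = x.1 by group)
  mul_smul g h x := Subtype.ext
    (show (g * h) * x.1 * (g * h)⁻¹ = g * (h * x.1 * h⁻¹) * g⁻¹ by group)

/-- The pointwise stabilizer of a subset of a `G`-set. -/
def pointStab (G : Type*) [Group G] {Ω : Type*} [MulAction G Ω] (X : Set Ω) : Subgroup G where
  carrier := {g | ∀ x ∈ X, g • x = x}
  one_mem' := by intro x _; simp
  mul_mem' := by intro a b ha hb x hx; rw [mul_smul, hb x hx, ha x hx]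
  inv_mem' := by intro a ha x hx; conv_lhs => rw [← ha x hx]
                 rw [inv_smul_smul]

/-- A group isomorphism `Perm α ≃* Perm β` induced by a bijection `α ≃ β`. -/
def permMulEquiv {α β : Type*} (e : α ≃ β) : Equiv.Perm α ≃* Equiv.Perm β where
  toFun p := (e.symm.trans p).trans e
  invFun q := (e.trans q).trans e.symm
  left_inv p := by ext a; simp
  right_inv q := by ext b; simp
  map_mul' p q := by ext b; simp

end PPaper
namespace PPaper

/-- Two fixed-point-free involutions of a nonempty set are centralized by a common
nontrivial involution, which reflects one cycle of the union of the two matchings. -/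
theorem exists_involution_commute {α : Type*} {x y : Equiv.Perm α} (hx : x * x = 1)
    (hy : y * y = 1) (hx' : ∀ a, x a ≠ a) (hy' : ∀ a, y a ≠ a) (a : α) :
    ∃ g : Equiv.Perm α, g * g = 1 ∧ g ≠ 1 ∧ Commute g x ∧ Commute g y := by
  classical
  obtain ⟨u, hu⟩ : ∃ u, u = x * y := ⟨_, rfl⟩
  have hyu : y = x * u := by rw [hu, ← mul_assoc, hx, one_mul]
  have hxu : SemiconjBy x u u⁻¹ := by
    rw [SemiconjBy, ← hyu, hu, mul_inv_rev, mul_assoc, inv_mul_cancel, mul_one]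
    exact (inv_eq_of_mul_eq_one_left hy).symm
  have hxx (b : α) : x (x b) = b := by rw [← Equiv.Perm.mul_apply, hx, Equiv.Perm.one_apply]
  have hxz (i : ℤ) (b : α) : x ((u ^ i) b) = (u ^ (-i)) (x b) := by
    have h := congrArg (fun p : Equiv.Perm α => p b) (hxu.zpow_right i).eq
    simpa using h
  have huu (i j : ℤ) (b : α) : (u ^ i) ((u ^ j) b) = (u ^ (i + j)) b := by
    rw [zpow_add, Equiv.Perm.mul_apply]
  have hu1 (i : ℤ) (b : α) : u ((u ^ i) b) = (u ^ (i + 1)) b := by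
    rw [add_comm, ← huu, zpow_one]
  have hne (i : ℤ) : (u ^ i) a ≠ x a := by
    intro h
    obtain ⟨j, rfl | rfl⟩ := Int.even_or_odd' i
    · apply hx' ((u ^ j) a)
      rw [hxz, ← h, huu]
      congr 2
      ring
    · apply hy' ((u ^ j) a)
      rw [hyu, Equiv.Perm.mul_apply, hu1, hxz, ← h, huu]
      congr 2
      ring
  have hne' (i j : ℤ) : (u ^ i) a ≠ (u ^ j) (x a) := by
    intro h
    apply hne (-j + i)
    rw [← huu, h, huu, neg_add_cancel, zpow_zero, Equiv.Perm.one_apply]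
  have hiff (i j : ℤ) (h : (u ^ i) a = (u ^ j) a) : (u ^ i) (x a) = (u ^ j) (x a) := by
    have h' : (u ^ (-i - j)) ((u ^ i) a) = (u ^ (-i - j)) ((u ^ j) a) := by rw [h]
    rw [huu, huu, show -i - j + i = -j by ring, show -i - j + j = -i by ring] at h'
    have h'' := congrArg x h'
    rwa [hxz, hxz, neg_neg, neg_neg, eq_comm] at h''
  have hiff' (i j : ℤ) (h : (u ^ i) (x a) = (u ^ j) (x a)) : (u ^ i) a = (u ^ j) a := by
    have h' : (u ^ (-i - j)) ((u ^ i) (x a)) = (u ^ (-i - j)) ((u ^ j) (x a)) := by rw [h]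
    rw [huu, huu, show -i - j + i = -j by ring, show -i - j + j = -i by ring] at h'
    have h'' := congrArg x h'
    rwa [hxz, hxz, neg_neg, neg_neg, hxx, eq_comm] at h''
  obtain ⟨f, hf⟩ : ∃ f : α → α, f = fun z =>
      if h : ∃ i : ℤ, (u ^ i) a = z then (u ^ h.choose) (x a)
      else if h : ∃ i : ℤ, (u ^ i) (x a) = z then (u ^ h.choose) a else z := ⟨_, rfl⟩
  have hf₁ (i : ℤ) : f ((u ^ i) a) = (u ^ i) (x a) := by
    have h : ∃ j : ℤ, (u ^ j) a = (u ^ i) a := ⟨i, rfl⟩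
    rw [hf]
    simp only [dif_pos h]
    exact hiff _ _ h.choose_spec
  have hf₂ (i : ℤ) : f ((u ^ i) (x a)) = (u ^ i) a := by
    have h₀ : ¬ ∃ j : ℤ, (u ^ j) a = (u ^ i) (x a) := fun ⟨j, hj⟩ => hne' _ _ hj
    have h : ∃ j : ℤ, (u ^ j) (x a) = (u ^ i) (x a) := ⟨i, rfl⟩
    rw [hf]
    simp only [dif_neg h₀, dif_pos h]
    exact hiff' _ _ h.choose_spec
  have hf₃ (z : α) (h₁ : ∀ i : ℤ, (u ^ i) a ≠ z) (h₂ : ∀ i : ℤ, (u ^ i) (x a) ≠ z) :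
      f z = z := by
    rw [hf]
    simp [h₁, h₂]
  have hcases (z : α) : (∃ i : ℤ, (u ^ i) a = z) ∨ (∃ i : ℤ, (u ^ i) (x a) = z) ∨
      ((∀ i : ℤ, (u ^ i) a ≠ z) ∧ ∀ i : ℤ, (u ^ i) (x a) ≠ z) := by
    by_cases h₁ : ∃ i : ℤ, (u ^ i) a = z
    · exact Or.inl h₁
    · by_cases h₂ : ∃ i : ℤ, (u ^ i) (x a) = z
      · exact Or.inr (Or.inl h₂)
      · exact Or.inr (Or.inr ⟨not_exists.1 h₁, not_exists.1 h₂⟩)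
  have hinv : Function.Involutive f := by
    intro z
    obtain ⟨i, rfl⟩ | ⟨i, rfl⟩ | ⟨h₁, h₂⟩ := hcases z
    · rw [hf₁, hf₂]
    · rw [hf₂, hf₁]
    · rw [hf₃ z h₁ h₂, hf₃ z h₁ h₂]
  have hfx (z : α) : f (x z) = x (f z) := by
    obtain ⟨i, rfl⟩ | ⟨i, rfl⟩ | ⟨h₁, h₂⟩ := hcases z
    · rw [hf₁, hxz, hxz, hf₂, hxx]
    · rw [hf₂, hxz, hxz, hxx, hf₁]
    · rw [hf₃ z h₁ h₂]
      refine hf₃ _ (fun i h => h₂ (-i) ?_) (fun i h => h₁ (-i) ?_)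
      · rw [← hxz, h, hxx]
      · have h' := congrArg x h
        rwa [hxz, hxx, hxx] at h'
  have hfu (z : α) : f (u z) = u (f z) := by
    obtain ⟨i, rfl⟩ | ⟨i, rfl⟩ | ⟨h₁, h₂⟩ := hcases z
    · rw [hf₁, hu1, hu1, hf₁]
    · rw [hf₂, hu1, hu1, hf₂]
    · rw [hf₃ z h₁ h₂]
      have key (b : α) (hb : ∀ i : ℤ, (u ^ i) b ≠ z) (i : ℤ) : (u ^ i) b ≠ u z := by
        intro h
        apply hb (i - 1)
        apply u.injective
        rw [hu1, sub_add_cancel, h]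
      exact hf₃ _ (key a h₁) (key (x a) h₂)
  have hgx : Commute hinv.toPerm x := Equiv.ext fun z => by simpa using hfx z
  have hgu : Commute hinv.toPerm u := Equiv.ext fun z => by simpa using hfu z
  refine ⟨hinv.toPerm, Equiv.ext fun z => by simpa using hinv z, fun h => ?_, hgx, ?_⟩
  · have h' := congrArg (fun p : Equiv.Perm α => p a) h
    have h₀ := hf₁ 0
    simp only [zpow_zero, Equiv.Perm.one_apply] at h₀
    simp only [Function.Involutive.coe_toPerm, Equiv.Perm.one_apply, h₀] at h'
    exact hx' a h'
  · rw [hyu]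
    exact hgx.mul_right hgu

/-- The identity of a projective module over a group algebra is a trace from the trivial
subgroup (Higman's criterion). -/
theorem exists_trace_eq_id (R G M : Type*) [CommRing R] [Group G] [Fintype G] [AddCommGroup M]
    [Module (MonoidAlgebra R G) M] [Module.Projective (MonoidAlgebra R G) M] :
    ∃ θ : M →+ M, ∀ v : M, ∑ g : G, MonoidAlgebra.of R G g •
      θ (MonoidAlgebra.of R G g⁻¹ • v) = v := by
  obtain ⟨s, hs⟩ := Module.projective_def'.1 ‹Module.Projective (MonoidAlgebra R G) M›
  let e : MonoidAlgebra R G →+ MonoidAlgebra R G :=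
    { toFun := fun b => MonoidAlgebra.single 1 (b.coeff 1)
      map_zero' := by simp
      map_add' := by simp }
  have he (b : MonoidAlgebra R G) :
      ∑ g : G, MonoidAlgebra.of R G g * e (MonoidAlgebra.of R G g⁻¹ * b) = b := by
    ext h
    simp [e, MonoidAlgebra.coeff_sum]
  let E : (M →₀ MonoidAlgebra R G) →+ (M →₀ MonoidAlgebra R G) := Finsupp.mapRange.addMonoidHom e
  have hE (w : M →₀ MonoidAlgebra R G) :
      ∑ g : G, MonoidAlgebra.of R G g • E (MonoidAlgebra.of R G g⁻¹ • w) = w := by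
    refine Finsupp.ext fun n => ?_
    rw [Finsupp.finsetSum_apply]
    exact he (w n)
  let π : (M →₀ MonoidAlgebra R G) →ₗ[MonoidAlgebra R G] M :=
    Finsupp.linearCombination (MonoidAlgebra R G) id
  refine ⟨(π.toAddMonoidHom.comp E).comp s.toAddMonoidHom, fun v => ?_⟩
  calc ∑ g : G, MonoidAlgebra.of R G g • π (E (s (MonoidAlgebra.of R G g⁻¹ • v)))
      = π (∑ g : G, MonoidAlgebra.of R G g • E (MonoidAlgebra.of R G g⁻¹ • s v)) := by
        simp only [map_sum, map_smul]
    _ = v := by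
        rw [hE]
        exact LinearMap.congr_fun hs v

/-- If any two points of `Ω` are fixed by a common involution of `G`, then in characteristic `2`
every trace from the trivial subgroup vanishes on the permutation module of `Ω`. -/
theorem trace_permMod_eq_zero {k G Ω : Type*} [CommRing k] [CharP k 2] [Group G] [Fintype G]
    [MulAction G Ω]
    (hΩ : ∀ x y : Ω, ∃ g : G, g * g = 1 ∧ g ≠ 1 ∧ g • x = x ∧ g • y = y)
    (ψ : MonoidAlgebra k Ω →+ MonoidAlgebra k Ω) (v : MonoidAlgebra k Ω) :
    ∑ g : G, Representation.ofMulAction k G Ω g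
      (ψ (Representation.ofMulAction k G Ω g⁻¹ v)) = 0 := by
  induction v using MonoidAlgebra.induction_linear with
  | zero => simp
  | add v w hv hw => simp only [map_add, Finset.sum_add_distrib, hv, hw, add_zero]
  | single y c =>
    ext x
    obtain ⟨h, hh, h1, hx, hy⟩ := hΩ x y
    simp only [Representation.ofMulAction_single, MonoidAlgebra.coeff_sum,
      Finsupp.finsetSum_apply, Representation.coeff_ofMulAction, MonoidAlgebra.coeff_zero,
      Finsupp.coe_zero, Pi.zero_apply]
    have hinv : h⁻¹ = h := inv_eq_of_mul_eq_one_left hh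
    refine Finset.sum_involution (fun g _ => h * g) ?_ ?_ (fun _ _ => Finset.mem_univ _) ?_
    · intro g _
      rw [mul_inv_rev, hinv, mul_smul, mul_smul, hx, hy]
      exact CharTwo.add_self_eq_zero _
    · intro g _ _ hg
      exact h1 (mul_eq_right.1 hg)
    · intro g _
      rw [← mul_assoc, hh, one_mul]

/-- (J. Murray) Over a field `k` of characteristic `2`, the permutation
`k Sym(2m)`-module `kΞ_{2m}` on the fixed-point-free involutions admits no projective
indecomposable direct summand. -/
theorem no_projective_component (k : Type) [Field k] [CharP k 2] (m : ℕ) (hm : 0 < m)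
    (M : Type) [AddCommGroup M] [Module (MonoidAlgebra k (Sym (2*m))) M]
    (hsum : IsSummand (MonoidAlgebra k (Sym (2*m))) M (PermMod k (Sym (2*m)) ↥(XiSet (2*m))))
    (hind : IsIndecomposable (MonoidAlgebra k (Sym (2*m))) M) :
    ¬ Module.Projective (MonoidAlgebra k (Sym (2*m))) M := by
  intro hproj
  obtain ⟨i, p, hpi⟩ := hsum
  obtain ⟨hnt, -⟩ := hind
  obtain ⟨θ, hθ⟩ := exists_trace_eq_id k (Sym (2*m)) M
  have hΩ (x y : XiSet (2*m)) :
      ∃ g : Sym (2*m), g * g = 1 ∧ g ≠ 1 ∧ g • x = x ∧ g • y = y := by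
    obtain ⟨g, hg, hg1, hgx, hgy⟩ := exists_involution_commute x.2.1 y.2.1 x.2.2 y.2.2
      ⟨0, by omega⟩
    exact ⟨g, hg, hg1, Subtype.ext (mul_inv_eq_of_eq_mul hgx.eq),
      Subtype.ext (mul_inv_eq_of_eq_mul hgy.eq)⟩
  let ρ := Representation.ofMulAction k (Sym (2*m)) (XiSet (2*m))
  let ψ : MonoidAlgebra k (XiSet (2*m)) →+ MonoidAlgebra k (XiSet (2*m)) :=
    (ρ.asModuleEquiv.toLinearMap.toAddMonoidHom.comp i.toAddMonoidHom).comp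
      (θ.comp (p.toAddMonoidHom.comp ρ.asModuleEquiv.symm.toLinearMap.toAddMonoidHom))
  obtain ⟨v, hv⟩ := exists_ne (0 : M)
  have hpiv (w : M) : p (i w) = w := LinearMap.congr_fun hpi w
  have hiv : i v = 0 := by
    apply ρ.asModuleEquiv.injective
    rw [map_zero, ← trace_permMod_eq_zero hΩ ψ (ρ.asModuleEquiv (i v))]
    conv_lhs => rw [← hθ v]
    rw [map_sum, map_sum]
    refine Finset.sum_congr rfl fun g _ => ?_
    have h₁ (w : M) (g : Sym (2*m)) : ρ.asModuleEquiv (i (MonoidAlgebra.of k _ g • w)) =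
        ρ g (ρ.asModuleEquiv (i w)) := by
      rw [map_smul, Representation.asModuleEquiv_map_smul, Representation.asAlgebraHom_of]
    rw [h₁, ← h₁ v]
    simp only [ψ, AddMonoidHom.comp_apply, LinearMap.toAddMonoidHom_coe, LinearEquiv.coe_coe,
      LinearEquiv.symm_apply_apply, hpiv]
    rfl
  exact hv (by rw [← hpiv v, hiv, map_zero])

end PPaper
end

section
/- Let G be a finite group, Ω a finite G-set, k a field of characteristic p, and X ⊆ Ω a closed subset. Then X is a fixed point set of kΩ if and only if kX, regarded as a permutation module for N̄_X = N_X/S_X, has a projective indecomposable direct summand. -/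
/-! Basic notions: direct summands, indecomposable modules, permutation modules,
relative projectivity, vertices, and fixed point sets of components, following
Broué and the paper. -/

open scoped Pointwise

namespace PPaper

open scoped Pointwise

/-- The homomorphism from the setwise stabilizer `N_X` of `X ⊆ Ω` to the permutations of
`X`; its kernel is the pointwise stabilizer `S_X`, so its range realises
`N̄_X = N_X / S_X` as a permutation group on `X`. -/
def stabPermHom (G : Type) [Group G] {Ω : Type} [MulAction G Ω] (X : Set Ω) :
    ↥(MulAction.stabilizer G X) →* Equiv.Perm ↥X where
  toFun g :=
    { toFun := fun x => ⟨g.1 • x.1, by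
        obtain ⟨v, hv⟩ := x
        have hg : g.1 • X = X := g.2
        exact (Set.ext_iff.mp hg _).mp (Set.smul_mem_smul_set hv)⟩
      invFun := fun x => ⟨g.1⁻¹ • x.1, by
        obtain ⟨v, hv⟩ := x
        have hg : g.1⁻¹ • X = X := (inv_mem g.2 : g.1⁻¹ ∈ MulAction.stabilizer G X)
        exact (Set.ext_iff.mp hg _).mp (Set.smul_mem_smul_set hv)⟩
      left_inv := fun x => Subtype.ext (inv_smul_smul g.1 x.1)
      right_inv := fun x => Subtype.ext (smul_inv_smul g.1 x.1) }
  map_one' := by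
    apply Equiv.ext; intro x
    apply Subtype.ext
    show (1 : G) • x.1 = x.1
    simp
  map_mul' g h := by
    apply Equiv.ext; intro x
    apply Subtype.ext
    show (g.1 * h.1) • x.1 = g.1 • (h.1 • x.1)
    rw [mul_smul]

set_option linter.unusedSectionVars false

section InvariantMatrices

open scoped Classical

variable {k G Ω : Type*} [Field k] [Group G] [MulAction G Ω] [Fintype Ω] [DecidableEq Ω]

variable (k Ω) in
/-- The algebra of matrices indexed by `Ω` that are invariant under the subgroup `H`. -/
def invMat (H : Subgroup G) : Subalgebra k (Matrix Ω Ω k) where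
  carrier := {a | ∀ h ∈ H, ∀ x y, a (h • x) (h • y) = a x y}
  mul_mem' := by
    intro a b ha hb h hh x y
    rw [Matrix.mul_apply, Matrix.mul_apply, ← Equiv.sum_comp (MulAction.toPerm h)]
    refine Finset.sum_congr rfl fun z _ => ?_
    rw [MulAction.toPerm_apply, ha h hh, hb h hh]
  add_mem' := by
    intro a b ha hb h hh x y
    rw [Matrix.add_apply, Matrix.add_apply, ha h hh, hb h hh]
  algebraMap_mem' := by
    intro r h hh x y
    simp [Matrix.algebraMap_matrix_apply]

theorem invMat_anti {H K : Subgroup G} (hHK : H ≤ K) : invMat k Ω K ≤ invMat k Ω H :=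
  fun _ ha h hh => ha h (hHK hh)

theorem apply_inv_smul_of_mem {H : Subgroup G} {a : Matrix Ω Ω k} (ha : a ∈ invMat k Ω H)
    {g g' : G} (h : (g : G ⧸ H) = g') (x y : Ω) :
    a (g⁻¹ • x) (g⁻¹ • y) = a (g'⁻¹ • x) (g'⁻¹ • y) := by
  have h1 : g⁻¹ * g' ∈ H := QuotientGroup.eq.1 h
  rw [← ha _ h1 (g'⁻¹ • x)]
  simp [smul_smul]

variable [Finite G]

/-- The relative trace map from `H`-invariant matrices to `G`-invariant matrices. -/
noncomputable def relTrace (H : Subgroup G) (a : Matrix Ω Ω k) : Matrix Ω Ω k :=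
  letI := Fintype.ofFinite (G ⧸ H)
  Matrix.of fun x y => ∑ q : G ⧸ H, a (q.out⁻¹ • x) (q.out⁻¹ • y)

theorem relTrace_apply (H : Subgroup G) [Fintype (G ⧸ H)] (a : Matrix Ω Ω k) (x y : Ω) :
    relTrace H a x y = ∑ q : G ⧸ H, a (q.out⁻¹ • x) (q.out⁻¹ • y) :=
  Finset.sum_congr (by ext; simp) fun _ _ => rfl

theorem relTrace_mem {H : Subgroup G} {a : Matrix Ω Ω k} (ha : a ∈ invMat k Ω H) :
    relTrace H a ∈ invMat k Ω (⊤ : Subgroup G) := by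
  cases nonempty_fintype G
  intro g _ x y
  rw [relTrace_apply, relTrace_apply, ← Equiv.sum_comp (MulAction.toPerm g)]
  refine Finset.sum_congr rfl fun q _ => ?_
  rw [MulAction.toPerm_apply]
  have : (((g • q).out : G) : G ⧸ H) = ((g * q.out : G) : G ⧸ H) := by
    rw [QuotientGroup.out_eq']
    conv_lhs => rw [← QuotientGroup.out_eq' q]
    rfl
  rw [apply_inv_smul_of_mem ha this]
  simp [smul_smul, mul_assoc]

theorem relTrace_mul_left {H : Subgroup G} {b : Matrix Ω Ω k}
    (hb : b ∈ invMat k Ω (⊤ : Subgroup G)) (a : Matrix Ω Ω k) :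
    relTrace H (b * a) = b * relTrace H a := by
  cases nonempty_fintype G
  ext x y
  simp only [relTrace_apply, Matrix.mul_apply, Finset.mul_sum]
  conv_rhs => rw [Finset.sum_comm]
  refine Finset.sum_congr rfl fun q _ => ?_
  rw [← Equiv.sum_comp (MulAction.toPerm (q.out⁻¹ : G))]
  refine Finset.sum_congr rfl fun z _ => ?_
  rw [MulAction.toPerm_apply, hb _ (Subgroup.mem_top _)]

theorem relTrace_mul_right {H : Subgroup G} {b : Matrix Ω Ω k}
    (hb : b ∈ invMat k Ω (⊤ : Subgroup G)) (a : Matrix Ω Ω k) :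
    relTrace H (a * b) = relTrace H a * b := by
  cases nonempty_fintype G
  ext x y
  simp only [relTrace_apply, Matrix.mul_apply, Finset.sum_mul]
  conv_rhs => rw [Finset.sum_comm]
  refine Finset.sum_congr rfl fun q _ => ?_
  rw [← Equiv.sum_comp (MulAction.toPerm (q.out⁻¹ : G))]
  refine Finset.sum_congr rfl fun z _ => ?_
  rw [MulAction.toPerm_apply, hb _ (Subgroup.mem_top _)]

theorem relTrace_smul (H : Subgroup G) (c : k) (a : Matrix Ω Ω k) :
    relTrace H (c • a) = c • relTrace H a := by
  cases nonempty_fintype G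
  ext x y
  simp [relTrace_apply, Finset.mul_sum]

theorem relTrace_sum {ι : Type*} (H : Subgroup G) (s : Finset ι) (a : ι → Matrix Ω Ω k) :
    relTrace H (∑ i ∈ s, a i) = ∑ i ∈ s, relTrace H (a i) := by
  cases nonempty_fintype G
  ext x y
  simp only [relTrace_apply, Matrix.sum_apply]
  exact Finset.sum_comm

theorem relTrace_trans {H K : Subgroup G} (hHK : H ≤ K) {a : Matrix Ω Ω k}
    (ha : a ∈ invMat k Ω H) :
    relTrace H a = relTrace K (relTrace (G := K) (H.subgroupOf K) a) := by
  cases nonempty_fintype G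
  ext x y
  simp only [relTrace_apply]
  rw [← Equiv.sum_comp (Subgroup.quotientEquivProdOfLE hHK).symm, Fintype.sum_prod_type]
  refine Finset.sum_congr rfl fun q _ => Finset.sum_congr rfl fun r _ => ?_
  have : ((((Subgroup.quotientEquivProdOfLE hHK).symm (q, r)).out : G) : G ⧸ H)
      = ((q.out * (r.out : K) : G) : G ⧸ H) := by
    rw [QuotientGroup.out_eq']
    conv_lhs => rw [← QuotientGroup.out_eq' r]
    rfl
  rw [apply_inv_smul_of_mem ha this]
  simp [smul_smul, Subgroup.smul_def]

theorem subgroupOf_inv {H K : Subgroup G} {a : Matrix Ω Ω k} (ha : a ∈ invMat k Ω H) :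
    a ∈ invMat k Ω (H.subgroupOf K) :=
  fun h hh x y => ha h (Subgroup.mem_subgroupOf.1 hh) x y

theorem relTrace_of_inv {H : Subgroup G} {a : Matrix Ω Ω k} {x y : Ω}
    (ha : ∀ g : G, a (g • x) (g • y) = a x y) :
    relTrace H a x y = (H.index : k) * a x y := by
  cases nonempty_fintype G
  simp only [relTrace_apply, ha, Finset.sum_const, Finset.card_univ, nsmul_eq_mul,
    Subgroup.index_eq_card, Nat.card_eq_fintype_card]

theorem relTrace_of_le {H K : Subgroup G} (hHK : H ≤ K) {a : Matrix Ω Ω k}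
    (ha : a ∈ invMat k Ω K) : relTrace H a = (H.relIndex K : k) • relTrace K a := by
  rw [relTrace_trans hHK (invMat_anti hHK ha), ← relTrace_smul]
  congr 1
  ext x y
  rw [relTrace_of_inv fun g : K => ha g g.2 x y]
  rfl

end InvariantMatrices

section PGroupSums

open scoped Classical

variable {k Q T : Type*} [Field k] [Group Q] [MulAction Q T] [Fintype T] [DecidableEq T]

theorem sum_eq_zero_of_isPGroup {p : ℕ} (hp : p.Prime) [CharP k p] (hQ : IsPGroup p Q)
    (F : T → k) (hF : ∀ (g : Q) t, F (g • t) = F t)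
    (h0 : ∀ t, (∀ g : Q, g • t = t) → F t = 0) : ∑ t, F t = 0 := by
  have := Fact.mk hp
  rw [← Finset.sum_fiberwise Finset.univ
    (fun t => (Quotient.mk'' t : MulAction.orbitRel.Quotient Q T)) F]
  refine Finset.sum_eq_zero fun o _ => ?_
  obtain ⟨t, rfl⟩ := Quotient.exists_rep o
  have hc : ∀ s ∈ Finset.univ.filter (fun s =>
      (Quotient.mk'' s : MulAction.orbitRel.Quotient Q T) = Quotient.mk _ t), F s = F t := by
    intro s hs
    obtain ⟨g, rfl⟩ := MulAction.orbitRel_apply.1 (Quotient.exact (Finset.mem_filter.1 hs).2)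
    exact hF g t
  rw [Finset.sum_congr rfl hc, Finset.sum_const, nsmul_eq_mul]
  obtain ⟨n, hn⟩ := hQ.card_orbit t
  have hcard : (Finset.univ.filter (fun s =>
      (Quotient.mk'' s : MulAction.orbitRel.Quotient Q T) = Quotient.mk _ t)).card = p ^ n := by
    rw [← hn, Nat.card_eq_fintype_card, Fintype.card_subtype]
    congr 1
    ext s
    simp only [Finset.mem_filter, Finset.mem_univ, true_and]
    exact ⟨fun h => MulAction.orbitRel_apply.1 (Quotient.exact h),
      fun h => Quotient.sound (MulAction.orbitRel_apply.2 h)⟩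
  rw [hcard]
  rcases n with _ | n
  · rw [h0 t, mul_zero]
    intro g
    rw [pow_zero, Nat.card_eq_one_iff_unique] at hn
    have := hn.1
    exact congrArg Subtype.val (Subsingleton.elim
      (⟨g • t, MulAction.mem_orbit t g⟩ : MulAction.orbit Q t) ⟨t, MulAction.mem_orbit_self t⟩)
  · simp [pow_succ]

/-- A sum of an invariant function over a `p`-group set in characteristic `p` may be restricted
to any invariant subset containing the fixed points. -/
theorem sum_eq_sum_ite_of_isPGroup {p : ℕ} (hp : p.Prime) [CharP k p] (hQ : IsPGroup p Q)
    (F : T → k) (hF : ∀ (g : Q) t, F (g • t) = F t) (U : Set T)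
    (hU : ∀ (g : Q) t, g • t ∈ U ↔ t ∈ U) (h0 : ∀ t, (∀ g : Q, g • t = t) → t ∈ U) :
    ∑ t, F t = ∑ t, if t ∈ U then F t else 0 := by
  rw [← sub_eq_zero, ← Finset.sum_sub_distrib]
  refine sum_eq_zero_of_isPGroup hp hQ _ (fun g t => ?_) (fun t ht => ?_)
  · simp only [hU, hF]
  · simp [h0 t ht]

end PGroupSums

section Brauer

open scoped Classical

variable {k G Ω : Type} [Field k] [Group G] [MulAction G Ω] [Fintype Ω]
  [DecidableEq Ω] {p : ℕ} [CharP k p]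
  {Q : Subgroup G} {X : Set Ω}

theorem smul_mem_fixSet_iff (hX : X = FixSet Ω Q) {g : G} (hg : g ∈ Q) (z : Ω) :
    g • z ∈ X ↔ z ∈ X := by
  subst hX
  constructor
  · intro h
    have h1 := h _ (inv_mem hg)
    rw [inv_smul_smul] at h1
    rwa [← h1] at h
  · intro h
    rwa [h g hg]

theorem mul_apply_of_isPGroup (hp : p.Prime) (hQ : IsPGroup p Q) (hX : X = FixSet Ω Q)
    {a b : Matrix Ω Ω k} (ha : a ∈ invMat k Ω Q) (hb : b ∈ invMat k Ω Q) (x y : X) :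
    (a * b) x y = ∑ z : X, a x z * b z y := by
  rw [Matrix.mul_apply, sum_eq_sum_ite_of_isPGroup (Q := Q) hp hQ _ _ X]
  · rw [← Finset.sum_filter]
    exact Finset.sum_subtype _ (by simp) _
  · exact fun g t => smul_mem_fixSet_iff hX g.2 t
  · intro t ht
    rw [hX]
    exact fun g hg => ht ⟨g, hg⟩
  · intro g t
    have hx : ∀ z : X, (g : G) • (z : Ω) = z := by
      subst hX
      exact fun z => z.2 _ g.2
    have h1 := ha _ g.2 x t
    have h2 := hb _ g.2 t y
    rw [hx] at h1 h2
    rw [← h1, ← h2]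
    rfl

/-- The Brauer homomorphism at a `p`-subgroup `Q` with fixed point set `X`: restriction of
`Q`-invariant matrices to `X × X`. -/
noncomputable def brauerHom (hp : p.Prime) (hQ : IsPGroup p Q) (hX : X = FixSet Ω Q) :
    invMat k Ω Q →ₐ[k] Matrix X X k where
  toFun a := a.1.submatrix (↑) (↑)
  map_one' := by
    ext x y
    simp [Matrix.one_apply, Subtype.ext_iff]
  map_mul' a b := by
    ext x y
    exact mul_apply_of_isPGroup hp hQ hX a.2 b.2 x y
  map_zero' := rfl
  map_add' _ _ := rfl
  commutes' r := by
    ext x y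
    simp [Matrix.algebraMap_matrix_apply, Subtype.ext_iff]

variable [Finite G]

theorem relTrace_apply_eq_zero (hp : p.Prime) (hQ : IsPGroup p Q) {H : Subgroup G}
    (hHQ : H < Q) {a : Matrix Ω Ω k} (ha : a ∈ invMat k Ω H) {x y : Ω}
    (hx : x ∈ FixSet Ω Q) (hy : y ∈ FixSet Ω Q) : relTrace H a x y = 0 := by
  cases nonempty_fintype G
  rw [relTrace_apply]
  refine sum_eq_zero_of_isPGroup (Q := Q) hp hQ _ (fun g q => ?_) (fun q hq => ?_)
  · have : (((g • q).out : G) : G ⧸ H) = (((g : G) * q.out : G) : G ⧸ H) := by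
      rw [QuotientGroup.out_eq']
      conv_lhs => rw [← QuotientGroup.out_eq' q]
      rfl
    rw [apply_inv_smul_of_mem ha this, mul_inv_rev, mul_smul, mul_smul,
      hx _ (inv_mem g.2), hy _ (inv_mem g.2)]
  · exfalso
    have hmem : ∀ g ∈ Q, (q.out)⁻¹ * g * q.out ∈ H := by
      intro g hg
      have h1 := hq ⟨g, hg⟩
      rw [← QuotientGroup.out_eq' q] at h1
      have h2 : ((g * q.out : G) : G ⧸ H) = (q.out : G) := h1
      have h3 := inv_mem (QuotientGroup.eq.1 h2)
      simpa [mul_assoc] using h3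
    have hinj : Function.Injective
        (fun g : Q => (⟨(q.out)⁻¹ * g * q.out, hmem g g.2⟩ : H)) := by
      intro g g' h
      simpa using h
    have hcard := Nat.card_le_card_of_injective _ hinj
    exact hHQ.ne (SetLike.coe_injective
      (Set.eq_of_subset_of_ncard_le hHQ.le hcard (Set.toFinite _)))

theorem mem_ker_stabPermHom {g : MulAction.stabilizer G X} :
    g ∈ (stabPermHom G X).ker ↔ ∀ x ∈ X, (g : G) • x = x := by
  rw [MonoidHom.mem_ker]
  constructor
  · intro h x hx
    exact congrArg Subtype.val (Equiv.congr_fun h ⟨x, hx⟩)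
  · intro h
    ext x
    exact h x x.2

theorem pointStab_le_stabilizer : pointStab G X ≤ MulAction.stabilizer G X := by
  intro g hg
  have h : ∀ x ∈ X, g • x = x := hg
  rw [MulAction.mem_stabilizer_iff]
  ext x
  rw [Set.mem_smul_set]
  constructor
  · rintro ⟨y, hy, rfl⟩
    rwa [h y hy]
  · exact fun hx => ⟨x, hx, h x hx⟩

theorem ker_stabPermHom :
    (stabPermHom G X).ker = (pointStab G X).subgroupOf (MulAction.stabilizer G X) := by
  ext g
  rw [mem_ker_stabPermHom]
  rfl

theorem relTrace_apply_fixSet_stabilizer (hp : p.Prime) (hQ : IsPGroup p Q)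
    (hX : X = FixSet Ω Q) {a : Matrix Ω Ω k} (ha : a ∈ invMat k Ω Q) (x y : X) :
    relTrace Q a x y = relTrace (G := MulAction.stabilizer G X)
      (Q.subgroupOf (MulAction.stabilizer G X)) a x y := by
  cases nonempty_fintype G
  set N := MulAction.stabilizer G X with hN
  have hfix : ∀ g ∈ Q, ∀ z : X, g • (z : Ω) = z := by
    subst hX
    exact fun g hg z => z.2 g hg
  have hQS : Q ≤ pointStab G X := fun g hg z hz => hfix g hg ⟨z, hz⟩
  have hQN : Q ≤ N := hQS.trans pointStab_le_stabilizer
  have hsmul : ∀ (g : Q) (q : G ⧸ Q),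
      (((g • q).out : G) : G ⧸ Q) = (((g : G) * q.out : G) : G ⧸ Q) := by
    intro g q
    rw [QuotientGroup.out_eq']
    conv_lhs => rw [← QuotientGroup.out_eq' q]
    rfl
  have hmemN : ∀ {g g' : G}, (g : G ⧸ Q) = g' → (g ∈ N ↔ g' ∈ N) := by
    intro g g' h
    have := hQN (QuotientGroup.eq.1 h)
    constructor
    · intro hg
      simpa using mul_mem hg this
    · intro hg
      simpa using mul_mem hg (inv_mem this)
  have step1 : relTrace Q a x y =
      ∑ q : G ⧸ Q, if q ∈ {q : G ⧸ Q | q.out ∈ N} then a (q.out⁻¹ • x) (q.out⁻¹ • y) else 0 := by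
    rw [relTrace_apply]
    refine sum_eq_sum_ite_of_isPGroup (Q := Q) hp hQ _ (fun g q => ?_) _ (fun g q => ?_)
      (fun q hq => ?_)
    · rw [apply_inv_smul_of_mem ha (hsmul g q), mul_inv_rev, mul_smul, mul_smul,
        hfix _ (inv_mem g.2), hfix _ (inv_mem g.2)]
    · rw [Set.mem_ofPred_eq, Set.mem_ofPred_eq, hmemN (hsmul g q)]
      exact Subgroup.mul_mem_cancel_left _ (hQN g.2)
    · have hmem : ∀ g ∈ Q, (q.out)⁻¹ * g * q.out ∈ Q := by
        intro g hg
        have h1 := hq ⟨g, hg⟩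
        rw [← QuotientGroup.out_eq' q] at h1
        have h2 : ((g * q.out : G) : G ⧸ Q) = (q.out : G) := h1
        have h3 := inv_mem (QuotientGroup.eq.1 h2)
        simpa [mul_assoc] using h3
      rw [Set.mem_ofPred_eq, hN, MulAction.mem_stabilizer_set_iff_smul_set_subset (Set.toFinite X)]
      rintro _ ⟨z, hz, rfl⟩
      rw [hX]
      intro h hh
      have h1 := hfix _ (hmem h hh) ⟨z, hz⟩
      rw [mul_smul, mul_smul, inv_smul_eq_iff] at h1
      exact h1
  rw [step1, relTrace_apply, ← Finset.sum_filter]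
  symm
  refine Finset.sum_bij (fun r _ => (((r.out : N) : G) : G ⧸ Q)) ?_ ?_ ?_ ?_
  · intro r _
    simp only [Finset.mem_filter, Finset.mem_univ, true_and, Set.mem_ofPred_eq]
    rw [hmemN (QuotientGroup.out_eq' _)]
    exact r.out.2
  · intro r _ r' _ h
    rw [← QuotientGroup.out_eq' r, ← QuotientGroup.out_eq' r']
    exact QuotientGroup.eq.2 (Subgroup.mem_subgroupOf.2 (QuotientGroup.eq.1 h))
  · intro q hq
    simp only [Finset.mem_filter, Finset.mem_univ, true_and, Set.mem_ofPred_eq] at hq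
    refine ⟨((⟨q.out, hq⟩ : N) : N ⧸ Q.subgroupOf N), Finset.mem_univ _, ?_⟩
    conv_rhs => rw [← QuotientGroup.out_eq' q]
    have := QuotientGroup.eq.1 (QuotientGroup.out_eq'
      (((⟨q.out, hq⟩ : N) : N ⧸ Q.subgroupOf N)))
    exact QuotientGroup.eq.2 (Subgroup.mem_subgroupOf.1 this)
  · intro r _
    exact apply_inv_smul_of_mem ha (QuotientGroup.out_eq' (((r.out : N) : G) : G ⧸ Q)).symm x y

theorem sum_quotient_ker_eq_sum_range {N M : Type*} [Group N] [Group M] (f : N →* M)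
    [Fintype (N ⧸ f.ker)] [Fintype f.range] (F : f.range → k) :
    ∑ q : N ⧸ f.ker, F ⟨f q.out, q.out, rfl⟩ = ∑ n, F n := by
  refine Fintype.sum_equiv (QuotientGroup.quotientKerEquivRange f).toEquiv _ _ fun q => ?_
  congr 1
  conv_rhs => rw [← QuotientGroup.out_eq' q]
  rfl

/-- The restriction of a relative trace to the fixed points of `Q`. -/
theorem relTrace_apply_fixSet [Fintype (stabPermHom G X).range] (hp : p.Prime)
    (hQ : IsPGroup p Q) (hX : X = FixSet Ω Q) {a : Matrix Ω Ω k} (ha : a ∈ invMat k Ω Q) (x y : X) :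
    relTrace Q a x y = (Q.relIndex (pointStab G X) : k) *
      ∑ n : (stabPermHom G X).range, a ((n⁻¹ • x : X)) ((n⁻¹ • y : X)) := by
  cases nonempty_fintype G
  have hQS : Q ≤ pointStab G X := by
    subst hX
    exact fun g hg z hz => hz g hg
  have hle : Q.subgroupOf (MulAction.stabilizer G X) ≤ (stabPermHom G X).ker := by
    rw [ker_stabPermHom]
    exact fun g hg => hQS hg
  rw [relTrace_apply_fixSet_stabilizer hp hQ hX ha, relTrace_trans hle (subgroupOf_inv ha),
    relTrace_apply, Finset.mul_sum]
  have hidx : (Q.subgroupOf (MulAction.stabilizer G X)).relIndex (stabPermHom G X).ker =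
      Q.relIndex (pointStab G X) := by
    rw [ker_stabPermHom]
    exact Subgroup.relIndex_subgroupOf pointStab_le_stabilizer
  rw [← hidx]
  have hg : ∀ (g : (stabPermHom G X).ker) (z : X), g • (z : Ω) = z :=
    fun g z => mem_ker_stabPermHom.1 g.2 z z.2
  have hinner : ∀ x' y' : X, relTrace (G := (stabPermHom G X).ker)
      ((Q.subgroupOf (MulAction.stabilizer G X)).subgroupOf (stabPermHom G X).ker) a x' y' =
      ((Q.subgroupOf (MulAction.stabilizer G X)).relIndex (stabPermHom G X).ker : k) * a x' y' :=
    fun x' y' => relTrace_of_inv fun g => by rw [hg, hg]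
  rw [← sum_quotient_ker_eq_sum_range (stabPermHom G X) 
    fun n => (_ : k) * a ((n⁻¹ • x : X)) ((n⁻¹ • y : X))]
  refine Finset.sum_congr (by ext; simp) fun r _ => ?_
  exact hinner ((stabPermHom G X r.out)⁻¹ • x) ((stabPermHom G X r.out)⁻¹ • y)

end Brauer

section PrimitiveIdempotents

variable {A : Type*} [Ring A]

/-- A primitive idempotent of a ring. -/
def IsPrimitiveIdem (e : A) : Prop :=
  e ≠ 0 ∧ e * e = e ∧ ∀ f, f * f = f → e * f = f → f * e = f → f = 0 ∨ f = e

/-- Every element `c` of a finite-dimensional algebra has a multiple in `k[c]` which is idempotent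
and modulo which `c` is nilpotent. -/
theorem exists_polynomial_idempotent (k : Type*) [Field k] [Algebra k A]
    [FiniteDimensional k A] (c : A) : ∃ q : Polynomial k,
    (c * Polynomial.aeval c q) * (c * Polynomial.aeval c q) = c * Polynomial.aeval c q ∧
    IsNilpotent (c * (1 - c * Polynomial.aeval c q)) := by
  have hint : IsIntegral k c := Algebra.IsIntegral.isIntegral c
  obtain ⟨r, hr, hnd⟩ := Polynomial.exists_eq_pow_rootMultiplicity_mul_and_not_dvd
    (minpoly k c) (minpoly.ne_zero hint) 0
  set n := (minpoly k c).rootMultiplicity 0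
  rw [Polynomial.C_0, sub_zero] at hr hnd
  have hcop : IsCoprime ((Polynomial.X : Polynomial k) ^ (n + 1)) r :=
    ((Polynomial.irreducible_X.coprime_iff_not_dvd).2 hnd).pow_left
  obtain ⟨u, v, huv⟩ := hcop
  have hmin : Polynomial.aeval c (Polynomial.X ^ n * r) = 0 := by
    rw [← hr, minpoly.aeval]
  have hX : ∀ s : Polynomial k,
      c * Polynomial.aeval c s = Polynomial.aeval c (Polynomial.X * s) := by
    intro s
    rw [map_mul, Polynomial.aeval_X]
  have he : c * Polynomial.aeval c (Polynomial.X ^ n * u)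
      = Polynomial.aeval c (u * Polynomial.X ^ (n + 1)) := by
    rw [hX, show (Polynomial.X : Polynomial k) * (Polynomial.X ^ n * u) =
      u * Polynomial.X ^ (n + 1) by ring]
  have h1 : 1 - Polynomial.aeval c (u * Polynomial.X ^ (n + 1)) = Polynomial.aeval c (v * r) := by
    rw [sub_eq_iff_eq_add, ← map_add, add_comm, huv, map_one]
  refine ⟨Polynomial.X ^ n * u, ?_, n + 1, ?_⟩
  · rw [he]
    have : Polynomial.aeval c (u * Polynomial.X ^ (n + 1)) *
        (1 - Polynomial.aeval c (u * Polynomial.X ^ (n + 1))) = 0 := by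
      rw [h1, ← map_mul, show u * Polynomial.X ^ (n + 1) * (v * r) =
        (Polynomial.X ^ n * r) * (u * Polynomial.X * v) by ring, map_mul, hmin, zero_mul]
    rw [mul_sub, mul_one, sub_eq_zero] at this
    exact this.symm
  · rw [he, h1, hX, ← map_pow, show ((Polynomial.X : Polynomial k) * (v * r)) ^ (n + 1) =
        (Polynomial.X ^ n * r) * (Polynomial.X * v ^ (n + 1) * r ^ n) by ring, map_mul, hmin,
        zero_mul]

theorem IsPrimitiveIdem.isNilpotent_or_exists_mul_eq (k : Type*) [Field k] [Algebra k A]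
    [FiniteDimensional k A] {e : A} (he : IsPrimitiveIdem e) {c : A}
    (hec : e * c = c) (hce : c * e = c) : IsNilpotent c ∨ ∃ d, c * d = e := by
  obtain ⟨q, hq, hnil⟩ := exists_polynomial_idempotent k c
  set f := c * Polynomial.aeval c q with hf
  have hcomm : Commute (Polynomial.aeval c q) e := by
    refine Polynomial.induction_on q (fun r => ?_) (fun p q hp hq => ?_) (fun n r _ => ?_)
    · rw [Polynomial.aeval_C]
      exact Algebra.commutes r e
    · rw [map_add]
      exact hp.add_left hq
    · rw [map_mul, map_pow, Polynomial.aeval_C, Polynomial.aeval_X]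
      exact Commute.mul_left (Algebra.commutes r e)
        (Commute.pow_left (show c * e = e * c by rw [hec, hce]) _)
  rcases he.2.2 f hq (by rw [hf, ← mul_assoc, hec])
    (by rw [hf, mul_assoc, hcomm.eq, ← mul_assoc, hce]) with h | h
  · left
    rwa [h, sub_zero, mul_one] at hnil
  · right
    exact ⟨_, h⟩

/-- Rosenberg's lemma: if a primitive idempotent factors through a finite sum, then it
factors through one of the summands. -/
theorem IsPrimitiveIdem.exists_mul_eq_of_sum (k : Type*) [Field k] [Algebra k A]
    [FiniteDimensional k A] {e : A} (he : IsPrimitiveIdem e) {ι : Type*}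
    (s : Finset ι) (t : ι → A) (ht : ∀ i, e * t i = t i) :
    ∀ v, (∑ i ∈ s, t i) * v = e → ∃ i, ∃ w, t i * w = e := by
  classical
  induction s using Finset.induction_on with
  | empty =>
    intro v hv
    rw [Finset.sum_empty, zero_mul] at hv
    exact absurd hv.symm he.1
  | insert i s hi ih =>
    intro v hv
    rw [Finset.sum_insert hi, add_mul] at hv
    have hidem := he.2.1
    have hec : e * (t i * v * e) = t i * v * e := by rw [← mul_assoc, ← mul_assoc, ht]
    have hce : (t i * v * e) * e = t i * v * e := by rw [mul_assoc, hidem]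
    have hsum : (t i * v * e) + (∑ i ∈ s, t i) * v * e = e := by rw [← add_mul, hv, hidem]
    rcases he.isNilpotent_or_exists_mul_eq k hec hce with ⟨n, hn⟩ | ⟨d, hd⟩
    · set c := t i * v * e
      have hr : (∑ i ∈ s, t i) * v * e = e * (1 - c) := by
        rw [mul_sub, mul_one, hec, eq_sub_iff_add_eq', hsum]
      refine ih (v * e * (∑ j ∈ Finset.range n, c ^ j) * e) ?_
      rw [← mul_assoc, ← mul_assoc, ← mul_assoc, hr, mul_assoc e, mul_neg_geom_sum, hn, sub_zero,
        mul_one, hidem]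
    · exact ⟨i, v * e * d, by simpa only [mul_assoc] using hd⟩

/-- An idempotent with a property inherited by one of the two parts of any orthogonal
decomposition dominates a primitive idempotent with this property. -/
theorem exists_isPrimitiveIdem (k : Type*) [Field k] [Algebra k A] [FiniteDimensional k A]
    (φ : A → Prop) (h0 : ¬ φ 0)
    (hφ : ∀ e f, e * e = e → f * f = f → e * f = f → f * e = f → φ e → φ f ∨ φ (e - f))
    (e : A) (he : e * e = e) (hφe : φ e) : ∃ e', IsPrimitiveIdem e' ∧ φ e' := by
  induction hn : Module.finrank k (LinearMap.range (LinearMap.mulLeft k e)) using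
    Nat.strong_induction_on generalizing e with
  | _ n ih =>
    by_cases hp : IsPrimitiveIdem e
    · exact ⟨e, hp, hφe⟩
    have hne : e ≠ 0 := fun h => h0 (h ▸ hφe)
    have key : ∀ g, g * g = g → e * g = g → g * e = g → g ≠ e → φ g →
        ∃ e', IsPrimitiveIdem e' ∧ φ e' := by
      intro g hg heg hge hgne hφg
      refine ih _ ?_ g hg hφg rfl
      rw [← hn]
      refine Submodule.finrank_lt_finrank_of_lt (lt_of_le_of_ne ?_ ?_)
      · rintro _ ⟨x, rfl⟩
        exact ⟨g * x, by simp [← mul_assoc, heg]⟩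
      · intro h
        have hmem : e ∈ LinearMap.range (LinearMap.mulLeft k g) := by
          rw [h]
          exact ⟨e, he⟩
        obtain ⟨x, hx⟩ := hmem
        rw [LinearMap.mulLeft_apply] at hx
        apply hgne
        rw [← hge]
        conv_lhs => rw [← hx, ← mul_assoc, hg]
        exact hx
    simp only [IsPrimitiveIdem, not_and, not_forall, not_or] at hp
    obtain ⟨f, hf, hef, hfe, hf0, hfne⟩ := hp hne he
    rcases hφ e f he hf hef hfe hφe with h | h
    · exact key f hf hef hfe hfne h
    · refine key (e - f) ?_ ?_ ?_ ?_ h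
      · simp [sub_mul, mul_sub, he, hf, hef, hfe]
      · simp [mul_sub, he, hef]
      · simp [sub_mul, he, hfe]
      · simpa using hf0

end PrimitiveIdempotents

section BrauerNonvanishing

open scoped Classical

variable {k G Ω : Type} [Field k] [Group G] [MulAction G Ω] [Fintype Ω] [DecidableEq Ω]

/-- The indicator matrix of an orbit of pairs, as a relative trace. -/
theorem relTrace_stabilizer_single [Finite G] (x y u v : Ω) :
    relTrace (MulAction.stabilizer G (x, y)) (Matrix.single x y (1 : k)) u v =
      if (Quotient.mk'' (u, v) : MulAction.orbitRel.Quotient G (Ω × Ω)) = Quotient.mk'' (x, y)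
        then 1 else 0 := by
  cases nonempty_fintype G
  have hiff : ∀ g : G, (x = g⁻¹ • u ∧ y = g⁻¹ • v) ↔ g • (x, y) = (u, v) := by
    intro g
    rw [Prod.smul_mk, Prod.mk.injEq, eq_inv_smul_iff, eq_inv_smul_iff]
  simp only [relTrace_apply, Matrix.single_apply, hiff]
  split_ifs with h
  · obtain ⟨g, hg⟩ := MulAction.orbitRel_apply.1 (Quotient.exact h)
    rw [Finset.sum_eq_single (g : G ⧸ MulAction.stabilizer G (x, y)), if_pos]
    · have := QuotientGroup.eq.1 (QuotientGroup.out_eq' (g : G ⧸ MulAction.stabilizer G (x, y)))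
      rw [MulAction.mem_stabilizer_iff, mul_smul, inv_smul_eq_iff] at this
      rw [← this]
      exact hg
    · intro q _ hq
      rw [if_neg]
      intro hq'
      apply hq
      rw [← QuotientGroup.out_eq' q]
      refine QuotientGroup.eq.2 ?_
      rw [MulAction.mem_stabilizer_iff, mul_smul, inv_smul_eq_iff, hq']
      exact hg
    · intro h
      exact absurd (Finset.mem_univ _) h
  · refine Finset.sum_eq_zero fun q _ => if_neg fun hq => h ?_
    exact Quotient.sound (MulAction.orbitRel_apply.2 ⟨_, hq⟩)

theorem eq_sum_relTrace_single [Finite G] {a : Matrix Ω Ω k}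
    (ha : ∀ (g : G) x y, a (g • x) (g • y) = a x y) :
    a = ∑ o : MulAction.orbitRel.Quotient G (Ω × Ω), a o.out.1 o.out.2 •
      relTrace (MulAction.stabilizer G o.out) (Matrix.single o.out.1 o.out.2 (1 : k)) := by
  ext u v
  have h : ∀ o : MulAction.orbitRel.Quotient G (Ω × Ω),
      relTrace (MulAction.stabilizer G o.out) (Matrix.single o.out.1 o.out.2 (1 : k)) u v =
      if (Quotient.mk'' (u, v) : MulAction.orbitRel.Quotient G (Ω × Ω)) = o then 1 else 0 := by
    intro o
    have := relTrace_stabilizer_single (k := k) (G := G) o.out.1 o.out.2 u v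
    rw [Prod.mk.eta] at this
    rw [this, show (Quotient.mk'' o.out : MulAction.orbitRel.Quotient G (Ω × Ω)) = o from
      Quotient.out_eq' o]
  simp only [Matrix.sum_apply, Matrix.smul_apply, h, smul_eq_mul, mul_ite, mul_one, mul_zero,
    Finset.sum_ite_eq, Finset.mem_univ, if_true]
  obtain ⟨g, hg⟩ := MulAction.orbitRel_apply.1 (Quotient.exact (Quotient.out_eq'
    (Quotient.mk'' (u, v) : MulAction.orbitRel.Quotient G (Ω × Ω))))
  have hg' : g • (u, v) = Quotient.out
    (Quotient.mk'' (u, v) : MulAction.orbitRel.Quotient G (Ω × Ω)) := hg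
  rw [← hg', Prod.smul_mk, ha]

/-- A primitive idempotent that is a relative trace from the `p`-subgroup `Q`, but from no proper
subgroup of `Q`, has nonzero image under the Brauer homomorphism at `Q`. -/
theorem IsPrimitiveIdem.exists_apply_ne_zero [Finite G] {p : ℕ} (hp : p.Prime) [CharP k p]
    {Q : Subgroup G} {X : Set Ω} (hQ : IsPGroup p Q) (hX : X = FixSet Ω Q)
    {e : invMat k Ω (⊤ : Subgroup G)} (he : IsPrimitiveIdem e)
    {a : Matrix Ω Ω k} (ha : a ∈ invMat k Ω Q) (hae : relTrace Q a = e)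
    (hmin : ∀ Q' ≤ Q, ∀ b ∈ invMat k Ω Q', relTrace Q' b = e → Q' = Q) :
    ∃ x y : X, (e : Matrix Ω Ω k) x y ≠ 0 := by
  by_contra! h0
  have heQ : (e : Matrix Ω Ω k) ∈ invMat k Ω Q := invMat_anti le_top e.2
  have hee : (e : Matrix Ω Ω k) * e = e := congrArg Subtype.val he.2.1
  set b := (e : Matrix Ω Ω k) * a * e with hb
  have hbQ : b ∈ invMat k Ω Q := mul_mem (mul_mem heQ ha) heQ
  have hbe : relTrace Q b = e := by
    rw [hb, relTrace_mul_right e.2, relTrace_mul_left e.2, hae, hee, hee]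
  have hb0 : ∀ x y : X, b x y = 0 := by
    intro x y
    rw [hb, mul_apply_of_isPGroup hp hQ hX (mul_mem heQ ha) heQ]
    exact Finset.sum_eq_zero fun z _ => by rw [h0, mul_zero]
  let H (o : MulAction.orbitRel.Quotient Q (Ω × Ω)) : Subgroup G :=
    (MulAction.stabilizer Q o.out).map Q.subtype
  let E (o : MulAction.orbitRel.Quotient Q (Ω × Ω)) : Matrix Ω Ω k :=
    b o.out.1 o.out.2 • Matrix.single o.out.1 o.out.2 (1 : k)
  have hHQ : ∀ o, H o ≤ Q := fun o => Subgroup.map_subtype_le _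
  have hE : ∀ o, E o ∈ invMat k Ω (H o) := by
    intro o
    refine Subalgebra.smul_mem _ ?_ _
    rintro _ ⟨g, hg, rfl⟩ u v
    have hg' : g • o.out = o.out := hg
    have h1 : (g : G) • o.out.1 = o.out.1 := congrArg Prod.fst hg'
    have h2 : (g : G) • o.out.2 = o.out.2 := congrArg Prod.snd hg'
    have h1' : ∀ w, o.out.1 = (g : G) • w ↔ o.out.1 = w := by
      intro w
      conv_lhs => rw [← h1, smul_left_cancel_iff]
    have h2' : ∀ w, o.out.2 = (g : G) • w ↔ o.out.2 = w := by
      intro w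
      conv_lhs => rw [← h2, smul_left_cancel_iff]
    simp only [Subgroup.subtype_apply, Matrix.single_apply, h1', h2']
  have hsum : ∑ o, relTrace (H o) (E o) = e := by
    rw [← hbe]
    conv_rhs => rw [eq_sum_relTrace_single (G := Q) (fun g x y => hbQ g g.2 x y), relTrace_sum]
    refine Finset.sum_congr rfl fun o _ => ?_
    rw [relTrace_trans (hHQ o) (hE o), ← relTrace_smul]
    congr 2
    exact Subgroup.comap_map_eq_self_of_injective Q.subtype_injective _
  let t (o : MulAction.orbitRel.Quotient Q (Ω × Ω)) : invMat k Ω (⊤ : Subgroup G) :=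
    e * ⟨relTrace (H o) (E o), relTrace_mem (hE o)⟩
  have ht : (∑ o, t o) * e = e := by
    rw [← Finset.mul_sum]
    apply Subtype.ext
    simp only [MulMemClass.coe_mul, AddSubmonoidClass.coe_finsetSum, hsum, hee]
  obtain ⟨o, w, how⟩ := he.exists_mul_eq_of_sum k Finset.univ t
    (fun o => by rw [← mul_assoc, he.2.1]) e ht
  have how' : (e : Matrix Ω Ω k) * relTrace (H o) (E o) * w = e := congrArg Subtype.val how
  have hH : H o = Q := by
    refine hmin _ (hHQ o) ((e : Matrix Ω Ω k) * E o * w) ?_ ?_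
    · exact mul_mem (mul_mem (invMat_anti le_top e.2) (hE o)) (invMat_anti le_top w.2)
    · rw [relTrace_mul_right w.2, relTrace_mul_left e.2, how']
  have hfix : ∀ g ∈ Q, g • o.out = o.out := by
    intro g hg
    rw [← hH] at hg
    obtain ⟨g, hg, rfl⟩ := hg
    exact hg
  have hE0 : E o = 0 := by
    have h1 : o.out.1 ∈ X := by
      rw [hX]
      exact fun g hg => congrArg Prod.fst (hfix g hg)
    have h2 : o.out.2 ∈ X := by
      rw [hX]
      exact fun g hg => congrArg Prod.snd (hfix g hg)
    have := hb0 ⟨_, h1⟩ ⟨_, h2⟩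
    simp only [E]
    rw [this, zero_smul]
  apply he.1
  apply Subtype.ext
  have hz : relTrace (H o) (E o) = 0 := by
    rw [hE0, ← zero_smul k (0 : Matrix Ω Ω k), relTrace_smul, zero_smul, zero_smul]
  rw [← how', hz, mul_zero, zero_mul]
  rfl

end BrauerNonvanishing

section AveragingMaps

open MonoidAlgebra

open scoped Classical

variable {k G M N M' N' : Type*} [Field k] [Group G]
  [AddCommGroup M] [Module (MonoidAlgebra k G) M] [AddCommGroup N] [Module (MonoidAlgebra k G) N]
  [AddCommGroup M'] [Module (MonoidAlgebra k G) M']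
  [AddCommGroup N'] [Module (MonoidAlgebra k G) N']

variable (k) in
/-- An additive map between `k[G]`-modules that is linear over `k[H]`, for a subgroup `H`. -/
def IsSubgroupLinear (H : Subgroup G) (α : M →+ N) : Prop :=
  ∀ h ∈ H, ∀ (c : k) m, α (single h c • m) = single h c • α m

/-- An additive map commuting with all `single g c` is `k[G]`-linear. -/
def IsSubgroupLinear.toLinearMap {α : M →+ N} (hα : IsSubgroupLinear k (⊤ : Subgroup G) α) :
    M →ₗ[MonoidAlgebra k G] N where
  toFun := α
  map_add' := α.map_add
  map_smul' r m := by
    rw [RingHom.id_apply]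
    induction r using MonoidAlgebra.induction_linear with
    | zero => rw [zero_smul, zero_smul, map_zero]
    | add r s hr hs => rw [add_smul, add_smul, map_add, hr, hs]
    | single g c => exact hα g (Subgroup.mem_top g) c m

theorem IsSubgroupLinear.toLinearMap_apply {α : M →+ N}
    (hα : IsSubgroupLinear k (⊤ : Subgroup G) α) (m : M) : hα.toLinearMap m = α m := rfl

theorem single_smul_single_inv_smul (g : G) (m : M) :
    single g (1 : k) • single g⁻¹ (1 : k) • m = m := by
  rw [smul_smul, single_mul_single, mul_inv_cancel, mul_one, ← one_def, one_smul]

variable [Finite G]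

variable (k) in
/-- The relative trace of an additive map between `k[G]`-modules. -/
noncomputable def trMap (H : Subgroup G) (α : M →+ N) : M →+ N :=
  letI := Fintype.ofFinite (G ⧸ H)
  ∑ q : G ⧸ H, ((DistribSMul.toAddMonoidHom N (single q.out (1 : k))).comp α).comp
    (DistribSMul.toAddMonoidHom M (single q.out⁻¹ (1 : k)))

theorem trMap_apply (H : Subgroup G) [Fintype (G ⧸ H)] (α : M →+ N) (m : M) :
    trMap k H α m =
      ∑ q : G ⧸ H, single q.out (1 : k) • α (single q.out⁻¹ (1 : k) • m) := by
  rw [trMap, AddMonoidHom.finsetSum_apply]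
  exact Finset.sum_congr (by ext; simp) fun _ _ => rfl

theorem IsSubgroupLinear.conj_eq {H : Subgroup G} {α : M →+ N} (hα : IsSubgroupLinear k H α)
    {g g' : G} (h : (g : G ⧸ H) = g') (m : M) :
    single g (1 : k) • α (single g⁻¹ (1 : k) • m) =
      single g' (1 : k) • α (single g'⁻¹ (1 : k) • m) := by
  have h1 : g'⁻¹ * g ∈ H := QuotientGroup.eq.1 h.symm
  have h2 : single g⁻¹ (1 : k) • m =
      single (g'⁻¹ * g)⁻¹ (1 : k) • single g'⁻¹ (1 : k) • m := by
    rw [smul_smul, single_mul_single]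
    simp
  rw [h2, hα _ (inv_mem h1), smul_smul, single_mul_single]
  simp

theorem IsSubgroupLinear.trMap {H : Subgroup G} {α : M →+ N} (hα : IsSubgroupLinear k H α) :
    IsSubgroupLinear k (⊤ : Subgroup G) (trMap k H α) := by
  cases nonempty_fintype G
  intro g _ c m
  have hc : ∀ (c : k) m, α (single (1 : G) c • m) = single (1 : G) c • α m := hα 1 (one_mem H)
  simp only [trMap_apply]
  rw [Finset.smul_sum, ← Equiv.sum_comp (MulAction.toPerm g)]
  refine Finset.sum_congr rfl fun q _ => ?_
  rw [MulAction.toPerm_apply]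
  have : (((g • q).out : G) : G ⧸ H) = ((g * q.out : G) : G ⧸ H) := by
    rw [QuotientGroup.out_eq']
    conv_lhs => rw [← QuotientGroup.out_eq' q]
    rfl
  rw [hα.conj_eq this]
  have h2 : single (g * q.out)⁻¹ (1 : k) • single g c • m =
      single (1 : G) c • single q.out⁻¹ (1 : k) • m := by
    simp only [smul_smul, single_mul_single]
    simp
  rw [h2, hc]
  simp only [smul_smul, single_mul_single]
  simp

theorem trMap_comp (H : Subgroup G) (p : N →ₗ[MonoidAlgebra k G] N')
    (i : M' →ₗ[MonoidAlgebra k G] M) (α : M →+ N) (m : M') :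
    trMap k H ((p.toAddMonoidHom.comp α).comp i.toAddMonoidHom) m = p (trMap k H α (i m)) := by
  cases nonempty_fintype G
  simp [trMap_apply, map_sum]

theorem IsSubgroupLinear.comp {H : Subgroup G} (p : N →ₗ[MonoidAlgebra k G] N')
    (i : M' →ₗ[MonoidAlgebra k G] M) {α : M →+ N} (hα : IsSubgroupLinear k H α) :
    IsSubgroupLinear k H ((p.toAddMonoidHom.comp α).comp i.toAddMonoidHom) := by
  intro h hh c m
  simp [hα h hh]

end AveragingMaps

section RelativeProjectivity

open MonoidAlgebra

open scoped Classical

variable {k G : Type u} [Field k] [Group G]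

/-- The truncation map `k[G] → k[G]` discarding the coefficients outside the subgroup `H`. -/
noncomputable def truncate (H : Subgroup G) : MonoidAlgebra k G →+ MonoidAlgebra k G :=
  (coeffAddEquiv.symm.toAddMonoidHom.comp (Finsupp.filterAddHom (· ∈ H))).comp
    coeffAddEquiv.toAddMonoidHom

theorem truncate_single_of_mem {H : Subgroup G} {g : G} (hg : g ∈ H) (c : k) :
    truncate H (single g c) = single g c := by
  have := Finsupp.filter_single_of_pos (M := k) (p := (· ∈ H)) (b := c) hg
  exact congrArg ofCoeff this

theorem truncate_single_of_notMem {H : Subgroup G} {g : G} (hg : g ∉ H) (c : k) :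
    truncate H (single g c) = 0 := by
  have := Finsupp.filter_single_of_neg (M := k) (p := (· ∈ H)) (b := c) hg
  exact congrArg ofCoeff this

theorem truncate_single_mul {H : Subgroup G} {h : G} (hh : h ∈ H) (c : k)
    (r : MonoidAlgebra k G) : truncate H (single h c * r) = single h c * truncate H r := by
  induction r using MonoidAlgebra.induction_linear with
  | zero => simp
  | add r s hr hs => rw [mul_add, map_add, map_add, mul_add, hr, hs]
  | single g d =>
    rw [single_mul_single]
    by_cases hg : g ∈ H
    · rw [truncate_single_of_mem hg, truncate_single_of_mem (mul_mem hh hg), single_mul_single]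
    · rw [truncate_single_of_notMem hg, truncate_single_of_notMem, mul_zero]
      rwa [Subgroup.mul_mem_cancel_left H hh]

theorem truncate_mul_single {H : Subgroup G} {h : G} (hh : h ∈ H) (c : k)
    (r : MonoidAlgebra k G) : truncate H (r * single h c) = truncate H r * single h c := by
  induction r using MonoidAlgebra.induction_linear with
  | zero => simp
  | add r s hr hs => rw [add_mul, map_add, map_add, add_mul, hr, hs]
  | single g d =>
    rw [single_mul_single]
    by_cases hg : g ∈ H
    · rw [truncate_single_of_mem hg, truncate_single_of_mem (mul_mem hg hh), single_mul_single]
    · rw [truncate_single_of_notMem hg, truncate_single_of_notMem, zero_mul]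
      rwa [Subgroup.mul_mem_cancel_right H hh]

theorem sum_truncate_mul_out (H : Subgroup G) [Fintype (G ⧸ H)] (r : MonoidAlgebra k G) :
    ∑ q : G ⧸ H, truncate H (r * single q.out 1) * single q.out⁻¹ 1 = r := by
  induction r using MonoidAlgebra.induction_linear with
  | zero => simp
  | add r s hr hs => simp only [add_mul, map_add, Finset.sum_add_distrib, hr, hs]
  | single g c =>
    simp only [single_mul_single, mul_one]
    have hmem : ∀ q : G ⧸ H, g * q.out ∈ H ↔ ((g⁻¹ : G) : G ⧸ H) = q := by
      intro q
      conv_rhs => rw [← QuotientGroup.out_eq' q]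
      rw [QuotientGroup.eq, inv_inv]
    rw [Finset.sum_eq_single ((g⁻¹ : G) : G ⧸ H)]
    · rw [truncate_single_of_mem ((hmem _).2 rfl), single_mul_single]
      simp
    · intro q _ hq
      rw [truncate_single_of_notMem (fun h => hq ((hmem q).1 h).symm), zero_mul]
    · intro h
      exact absurd (Finset.mem_univ _) h

theorem grpRingHom_single (H : Subgroup G) (h : H) (c : k) :
    grpRingHom k H.subtype (single h c) = single (h : G) c := by
  simp [grpRingHom]

theorem truncate_grpRingHom_mul (H : Subgroup G) (s : MonoidAlgebra k H)
    (r : MonoidAlgebra k G) :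
    truncate H (grpRingHom k H.subtype s * r) = grpRingHom k H.subtype s * truncate H r := by
  induction s using MonoidAlgebra.induction_linear with
  | zero => simp
  | add s t hs ht => rw [map_add, add_mul, map_add, add_mul, hs, ht]
  | single h c => rw [grpRingHom_single, truncate_single_mul h.2]

/-- Evaluation of an element of an induced module, as a function on the group algebra. -/
noncomputable def indEval (H : Subgroup G) (L : ModuleCat.{u} (MonoidAlgebra k H)) :
    IndMod H L →+ (MonoidAlgebra k G →+ L) where
  toFun φ :=
    { toFun := fun r => ModuleCat.CoextendScalars.equiv (grpRingHom k H.subtype) L φ r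
      map_zero' := (ModuleCat.CoextendScalars.equiv (grpRingHom k H.subtype) L φ).map_zero
      map_add' := (ModuleCat.CoextendScalars.equiv (grpRingHom k H.subtype) L φ).map_add }
  map_zero' := rfl
  map_add' _ _ := rfl

variable {H : Subgroup G} {L : ModuleCat.{u} (MonoidAlgebra k H)}

theorem indEval_injective : Function.Injective (indEval H L) := fun _ _ h =>
  ModuleCat.CoextendScalars.ext (LinearMap.ext fun r => DFunLike.congr_fun h r)

theorem indEval_smul (r : MonoidAlgebra k G) (φ : IndMod H L) (s : MonoidAlgebra k G) :
    indEval H L (r • φ) s = indEval H L φ (s * r) := rfl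

theorem indEval_mul (φ : IndMod H L) (s : MonoidAlgebra k H) (r : MonoidAlgebra k G) :
    indEval H L φ (grpRingHom k H.subtype s * r) = s • indEval H L φ r :=
  (ModuleCat.CoextendScalars.equiv (grpRingHom k H.subtype) L φ).map_smul s _

/-- The element of an induced module given by a semilinear function on the group algebra. -/
noncomputable def indMk (f : MonoidAlgebra k G →+ L)
    (hf : ∀ (s : MonoidAlgebra k H) r, f (grpRingHom k H.subtype s * r) = s • f r) :
    IndMod H L :=
  (ModuleCat.CoextendScalars.equiv (grpRingHom k H.subtype) L).symm
    { toFun := fun r => f r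
      map_add' := fun r s => f.map_add r s
      map_smul' := fun s r => hf s r }

variable (H L) in
/-- The endomorphism of an induced module obtained by precomposition with truncation. -/
noncomputable def indTruncate : IndMod H L →+ IndMod H L where
  toFun φ := indMk ((indEval H L φ).comp (truncate H)) fun s r => by
    rw [AddMonoidHom.comp_apply, truncate_grpRingHom_mul, indEval_mul, AddMonoidHom.comp_apply]
  map_zero' := rfl
  map_add' _ _ := rfl

theorem indEval_indTruncate (φ : IndMod H L) (r : MonoidAlgebra k G) :
    indEval H L (indTruncate H L φ) r = indEval H L φ (truncate H r) := rfl

theorem isRelProjective_iff [Finite G] (M : Type u) [AddCommGroup M]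
    [Module (MonoidAlgebra k G) M] (H : Subgroup G) : IsRelProjective k M H ↔
      ∃ α : M →+ M, IsSubgroupLinear k H α ∧ ∀ m, trMap k H α m = m := by
  cases nonempty_fintype G
  constructor
  · rintro ⟨L, i, p, hpi⟩
    have hlin : IsSubgroupLinear k H (indTruncate H L) := by
      intro h hh c φ
      refine indEval_injective (AddMonoidHom.ext fun r => ?_)
      simp only [indEval_indTruncate, indEval_smul, truncate_mul_single hh]
    refine ⟨_, hlin.comp p i, fun m => ?_⟩
    rw [trMap_comp]
    have htr : trMap k H (indTruncate H L) (i m) = i m := by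
      refine indEval_injective (AddMonoidHom.ext fun r => ?_)
      rw [trMap_apply, map_sum, AddMonoidHom.finsetSum_apply]
      simp only [indEval_indTruncate, indEval_smul]
      rw [← map_sum, sum_truncate_mul_out]
    rw [htr]
    exact LinearMap.congr_fun hpi m
  · rintro ⟨α, hα, hm⟩
    let L : ModuleCat.{u} (MonoidAlgebra k H) :=
      (ModuleCat.restrictScalars (grpRingHom k H.subtype)).obj (ModuleCat.of _ M)
    have hL : ∀ (h : H) (c : k) (l : L), single h c • l =
        (single (h : G) c • (show M from l) : M) := by
      intro h c l
      rw [← grpRingHom_single]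
      rfl
    let i : M →ₗ[MonoidAlgebra k G] IndMod H L :=
      ModuleCat.RestrictionCoextensionAdj.app' (grpRingHom k H.subtype) (ModuleCat.of _ M)
    have hi : ∀ m r, indEval H L (i m) r = (r • m : M) := fun _ _ => rfl
    let ε : IndMod H L →+ M :=
      { toFun := fun φ => (indEval H L φ 1 : M)
        map_zero' := rfl
        map_add' := fun _ _ => rfl }
    have hε : IsSubgroupLinear k H ε := by
      intro h hh c φ
      show (indEval H L (single h c • φ) 1 : M) = _
      rw [indEval_smul, one_mul]
      have := indEval_mul φ (single ⟨h, hh⟩ c) 1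
      rw [grpRingHom_single, mul_one, hL] at this
      exact this
    have hαε : IsSubgroupLinear k H (α.comp ε) := by
      intro h hh c φ
      rw [AddMonoidHom.comp_apply, hε h hh, hα h hh, AddMonoidHom.comp_apply]
    refine ⟨L, i, hαε.trMap.toLinearMap, LinearMap.ext fun m => ?_⟩
    rw [LinearMap.comp_apply, IsSubgroupLinear.toLinearMap_apply, LinearMap.id_apply]
    conv_rhs => rw [← hm m]
    rw [trMap_apply, trMap_apply]
    refine Finset.sum_congr rfl fun q _ => ?_
    rw [AddMonoidHom.comp_apply, ← i.map_smul]
    have h1 : ∀ m, ε (i m) = m := fun m => (hi m 1).trans (one_smul _ m)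
    rw [h1]

end RelativeProjectivity

section Projectivity

open MonoidAlgebra

open scoped Classical

variable {k G : Type*} [Field k] [Group G]

/-- The map `k[G] → k[G]` keeping only the coefficient of the identity. -/
noncomputable def coeffOne : MonoidAlgebra k G →+ MonoidAlgebra k G where
  toFun r := single 1 (r.coeff 1)
  map_zero' := by simp
  map_add' r s := by rw [coeff_add, Finsupp.add_apply, single_add]

theorem coeffOne_single_one_mul (c : k) (r : MonoidAlgebra k G) :
    coeffOne (single 1 c * r) = single 1 c * coeffOne r := by
  simp [coeffOne, single_mul_single]

theorem sum_out_bot [Finite G] [Fintype G] [Fintype (G ⧸ (⊥ : Subgroup G))] {A : Type*}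
    [AddCommMonoid A] (F : G → A) : ∑ q : G ⧸ (⊥ : Subgroup G), F q.out = ∑ g, F g := by
  refine Fintype.sum_bijective Quotient.out ⟨Quotient.out_injective, fun g => ?_⟩ _ _ fun _ => rfl
  refine ⟨(g : G ⧸ (⊥ : Subgroup G)), ?_⟩
  have := QuotientGroup.eq.1 (QuotientGroup.out_eq' (g : G ⧸ (⊥ : Subgroup G)))
  rw [Subgroup.mem_bot, inv_mul_eq_one] at this
  exact this

theorem sum_single_mul_coeffOne [Fintype G] (r : MonoidAlgebra k G) :
    ∑ g : G, single g 1 * coeffOne (single g⁻¹ 1 * r) = r := by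
  ext h
  simp [coeffOne, single_mul_single, coeff_sum]

theorem single_one_smul {N : Type*} [AddCommGroup N] [Module (MonoidAlgebra k G) N] [Module k N]
    [IsScalarTower k (MonoidAlgebra k G) N] (c : k) (n : N) : single (1 : G) c • n = c • n := by
  rw [← mul_one c, ← smul_eq_mul, ← smul_single, smul_assoc, ← one_def, one_smul, smul_eq_mul,
    mul_one]

theorem projective_iff [Finite G] (M : Type*) [AddCommGroup M]
    [Module (MonoidAlgebra k G) M] : Module.Projective (MonoidAlgebra k G) M ↔
      ∃ α : M →+ M, IsSubgroupLinear k (⊥ : Subgroup G) α ∧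
        ∀ m, trMap k (⊥ : Subgroup G) α m = m := by
  cases nonempty_fintype G
  constructor
  · rintro ⟨s, hs⟩
    let T : (M →₀ MonoidAlgebra k G) →+ (M →₀ MonoidAlgebra k G) :=
      Finsupp.mapRange.addMonoidHom coeffOne
    have hT : IsSubgroupLinear k (⊥ : Subgroup G) T := by
      intro h hh c F
      rw [Subgroup.mem_bot.1 hh]
      ext1 x
      exact coeffOne_single_one_mul c (F x)
    refine ⟨_, hT.comp (Finsupp.linearCombination (MonoidAlgebra k G) id) s, fun m => ?_⟩
    rw [trMap_comp]
    have htr : trMap k (⊥ : Subgroup G) T (s m) = s m := by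
      ext1 x
      rw [trMap_apply, sum_out_bot fun g => single g (1 : k) • T (single g⁻¹ (1 : k) • s m),
        Finsupp.finsetSum_apply]
      exact sum_single_mul_coeffOne (s m x)
    rw [htr]
    exact hs m
  · rintro ⟨α, hα, hm⟩
    let : Module k M := Module.compHom M (algebraMap k (MonoidAlgebra k G))
    have : IsScalarTower k (MonoidAlgebra k G) M := ⟨fun c r m => by
      rw [Algebra.smul_def, mul_smul]
      rfl⟩
    let π := Finsupp.linearCombination (MonoidAlgebra k G) (id : M → M)
    have hπ : Function.Surjective π := Finsupp.linearCombination_id_surjective _ M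
    obtain ⟨s, hs⟩ := (π.restrictScalars k).exists_rightInverse_of_surjective
      (LinearMap.range_eq_top.2 hπ)
    have hsα : IsSubgroupLinear k (⊥ : Subgroup G) (s.toAddMonoidHom.comp α) := by
      intro h hh c m
      rw [AddMonoidHom.comp_apply, hα h hh, Subgroup.mem_bot.1 hh]
      rw [single_one_smul, single_one_smul]
      exact s.map_smul c _
    refine ⟨hsα.trMap.toLinearMap, fun m => ?_⟩
    rw [IsSubgroupLinear.toLinearMap_apply]
    conv_rhs => rw [← hm m]
    rw [trMap_apply, trMap_apply, map_sum]
    refine Finset.sum_congr rfl fun q _ => ?_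
    rw [map_smul]
    congr 1
    exact LinearMap.congr_fun hs _

end Projectivity

section PermutationModules

open MonoidAlgebra

open scoped Classical

variable {k G Ω : Type u} [Field k] [Group G] [MulAction G Ω] [Fintype Ω] [DecidableEq Ω]

variable (k G Ω) in
/-- The standard basis of a permutation module. -/
noncomputable def permBasis : Module.Basis Ω k (PermMod k G Ω) :=
  Module.Basis.ofRepr ((Representation.ofMulAction k G Ω).asModuleEquiv.trans
    (coeffLinearEquiv k))

theorem permBasis_apply (x : Ω) : (Representation.ofMulAction k G Ω).asModuleEquiv
    (permBasis k G Ω x) = single x 1 := rfl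

theorem single_smul_permBasis (g : G) (x : Ω) :
    single g (1 : k) • permBasis k G Ω x = permBasis k G Ω (g • x) := by
  rw [Representation.single_smul, one_smul, permBasis_apply, Representation.ofMulAction_single]
  rfl

variable (G) in
/-- The action of matrices on a permutation module. -/
noncomputable def permEnd : Matrix Ω Ω k ≃ₐ[k] Module.End k (PermMod k G Ω) :=
  (LinearMap.toMatrixAlgEquiv (permBasis k G Ω)).symm

theorem permEnd_permBasis (a : Matrix Ω Ω k) (y : Ω) :
    permEnd G a (permBasis k G Ω y) = ∑ x, a x y • permBasis k G Ω x := by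
  exact Matrix.toLinAlgEquiv_self (permBasis k G Ω) a y

theorem single_smul_eq (g : G) (c : k) (v : PermMod k G Ω) :
    single g c • v = c • single g (1 : k) • v := by
  rw [← smul_assoc, smul_single, smul_eq_mul, mul_one]

theorem single_one_smul_smul (g : G) (c : k) (v : PermMod k G Ω) :
    single g (1 : k) • c • v = c • single g (1 : k) • v :=
  (GroupSMul.linearMap k (PermMod k G Ω) g).map_smul c v

theorem permEnd_conj (g : G) (a : Matrix Ω Ω k) (v : PermMod k G Ω) :
    permEnd G (Matrix.of fun x y => a (g⁻¹ • x) (g⁻¹ • y)) v =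
      single g (1 : k) • permEnd G a (single g⁻¹ (1 : k) • v) := by
  suffices h : permEnd G (Matrix.of fun x y => a (g⁻¹ • x) (g⁻¹ • y)) =
      (GroupSMul.linearMap k (PermMod k G Ω) g).comp
        ((permEnd G a).comp (GroupSMul.linearMap k (PermMod k G Ω) g⁻¹)) from
    LinearMap.congr_fun h v
  refine (permBasis k G Ω).ext fun y => ?_
  rw [LinearMap.comp_apply, LinearMap.comp_apply, GroupSMul.linearMap_apply,
    GroupSMul.linearMap_apply, single_smul_permBasis, permEnd_permBasis, permEnd_permBasis,
    Finset.smul_sum, ← Equiv.sum_comp (MulAction.toPerm g)]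
  refine Finset.sum_congr rfl fun x _ => ?_
  rw [single_one_smul_smul, single_smul_permBasis]
  simp

theorem isSubgroupLinear_permEnd_iff {H : Subgroup G} {a : Matrix Ω Ω k} :
    IsSubgroupLinear k H (permEnd G a).toAddMonoidHom ↔ a ∈ invMat k Ω H := by
  have key : ∀ g : G, (Matrix.of fun x y => a (g⁻¹ • x) (g⁻¹ • y)) = a ↔
      ∀ v, permEnd G a (single g (1 : k) • v) = single g (1 : k) • permEnd G a v := by
    intro g
    rw [← (permEnd G).injective.eq_iff, LinearMap.ext_iff]
    simp only [permEnd_conj]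
    constructor
    · intro h v
      rw [← h (single g (1 : k) • v)]
      have := single_smul_single_inv_smul (k := k) g⁻¹ v
      rw [inv_inv] at this
      rw [this]
    · intro h v
      rw [← h, single_smul_single_inv_smul]
  constructor
  · intro h g hg x y
    have := (key g).2 fun v => h g hg 1 v
    conv_lhs => rw [← this]
    simp
  · intro ha g hg c v
    rw [single_smul_eq, single_smul_eq g c]
    refine ((permEnd G a).map_smul c _).trans ?_
    congr 1
    refine (key g).1 ?_ v
    ext x y
    exact ha _ (inv_mem hg) x y

theorem IsSubgroupLinear.exists_permEnd {H : Subgroup G} {f : PermMod k G Ω →+ PermMod k G Ω}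
    (hf : IsSubgroupLinear k H f) : ∃ a ∈ invMat k Ω H, ∀ v, permEnd G a v = f v := by
  let f' : Module.End k (PermMod k G Ω) :=
    { f with
      map_smul' := fun c v => by
        have := hf 1 (one_mem H) c v
        rwa [single_one_smul, single_one_smul] at this }
  refine ⟨(permEnd G).symm f', isSubgroupLinear_permEnd_iff.1 ?_, fun v => ?_⟩
  · rw [AlgEquiv.apply_symm_apply]
    exact hf
  · rw [AlgEquiv.apply_symm_apply]
    rfl

theorem permEnd_relTrace [Finite G] (H : Subgroup G) (a : Matrix Ω Ω k) (v : PermMod k G Ω) :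
    permEnd G (relTrace H a) v = trMap k H (permEnd G a).toAddMonoidHom v := by
  cases nonempty_fintype G
  have : relTrace H a =
      ∑ q : G ⧸ H, Matrix.of fun x y => a (q.out⁻¹ • x) (q.out⁻¹ • y) := by
    ext x y
    simp [relTrace_apply, Matrix.sum_apply]
  rw [this, map_sum, LinearMap.sum_apply, trMap_apply]
  exact Finset.sum_congr rfl fun q _ => permEnd_conj _ _ _

end PermutationModules

section SummandsAndIdempotents

open MonoidAlgebra

open scoped Classical

variable {k G Ω : Type u} [Field k] [Group G] [MulAction G Ω] [Fintype Ω] [DecidableEq Ω]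
  {M : Type*} [AddCommGroup M] [Module (MonoidAlgebra k G) M]

variable (M) in
/-- The module `M` is isomorphic to the image of the idempotent matrix `e` acting on the
permutation module. -/
def IsImageOf (e : Matrix Ω Ω k) : Prop :=
  ∃ (i : M →ₗ[MonoidAlgebra k G] PermMod k G Ω) (p : PermMod k G Ω →ₗ[MonoidAlgebra k G] M),
    (∀ m, p (i m) = m) ∧ ∀ v, i (p v) = permEnd G e v

theorem IsImageOf.isSummand {e : Matrix Ω Ω k} (h : IsImageOf (G := G) M e) :
    IsSummand (MonoidAlgebra k G) M (PermMod k G Ω) := by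
  obtain ⟨i, p, hpi, -⟩ := h
  exact ⟨i, p, LinearMap.ext hpi⟩

theorem isSubgroupLinear_linearMap (H : Subgroup G) {N : Type*} [AddCommGroup N]
    [Module (MonoidAlgebra k G) N] (f : M →ₗ[MonoidAlgebra k G] N) :
    IsSubgroupLinear k H f.toAddMonoidHom := fun g _ c m => f.map_smul (single g c) m

theorem permEnd_mul_apply (a b : Matrix Ω Ω k) (v : PermMod k G Ω) :
    permEnd G (a * b) v = permEnd G a (permEnd G b v) := by
  rw [map_mul]
  rfl

theorem permEnd_inj {a b : Matrix Ω Ω k} (h : ∀ v, permEnd G a v = permEnd G b v) : a = b :=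
  (permEnd G).injective (LinearMap.ext h)

theorem IsSummand.exists_isImageOf (h : IsSummand (MonoidAlgebra k G) M (PermMod k G Ω)) :
    ∃ e ∈ invMat k Ω (⊤ : Subgroup G), e * e = e ∧ IsImageOf (G := G) M e := by
  obtain ⟨i, p, hpi⟩ := h
  obtain ⟨e, he, hev⟩ := (isSubgroupLinear_linearMap (⊤ : Subgroup G) (i.comp p)).exists_permEnd
  have hev' : ∀ v, i (p v) = permEnd G e v := fun v => (hev v).symm
  have hpi' : ∀ m, p (i m) = m := LinearMap.congr_fun hpi
  refine ⟨e, he, permEnd_inj (G := G) fun v => ?_, i, p, hpi', hev'⟩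
  rw [permEnd_mul_apply, ← hev', ← hev', hpi']

theorem exists_isImageOf {e : Matrix Ω Ω k} (he : e ∈ invMat k Ω (⊤ : Subgroup G))
    (hee : e * e = e) :
    ∃ M : ModuleCat.{max u v} (MonoidAlgebra k G), IsImageOf (G := G) M e := by
  have hlin := isSubgroupLinear_permEnd_iff.2 he
  let f := hlin.toLinearMap
  have hf : ∀ v, f v = permEnd G e v := fun _ => rfl
  have hff : ∀ v, f (f v) = f v := fun v => by rw [hf, hf, ← permEnd_mul_apply, hee]
  let u : ULift.{v} (LinearMap.range f) ≃ₗ[MonoidAlgebra k G] LinearMap.range f :=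
    ULift.moduleEquiv
  refine ⟨ModuleCat.of _ (ULift.{v} (LinearMap.range f)),
    (LinearMap.range f).subtype.comp u.toLinearMap, u.symm.toLinearMap.comp f.rangeRestrict,
    fun m => ?_, fun v => ?_⟩
  · obtain ⟨⟨_, v, rfl⟩⟩ := m
    exact congrArg u.symm (Subtype.ext (hff v))
  · rfl

theorem IsImageOf.isIndecomposable_iff {e : invMat k Ω (⊤ : Subgroup G)} (hee : e * e = e)
    (h : IsImageOf (G := G) M (e : Matrix Ω Ω k)) :
    IsIndecomposable (MonoidAlgebra k G) M ↔ IsPrimitiveIdem e := by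
  obtain ⟨i, p, hpi, hip⟩ := h
  have hi : Function.Injective i := Function.LeftInverse.injective hpi
  constructor
  · rintro ⟨hM, hid⟩
    refine ⟨?_, hee, fun f hf hef hfe => ?_⟩
    · rintro rfl
      obtain ⟨m, hm⟩ := exists_ne (0 : M)
      apply hm
      rw [← hpi m, ← hpi (p (i m)), hip]
      simp
    · have hef' : (e : Matrix Ω Ω k) * f = f := congrArg Subtype.val hef
      have hfe' : (f : Matrix Ω Ω k) * e = f := congrArg Subtype.val hfe
      have hf' : (f : Matrix Ω Ω k) * f = f := congrArg Subtype.val hf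
      let F := (isSubgroupLinear_permEnd_iff.2 f.2).toLinearMap
      have hF : ∀ v, F v = permEnd G (f : Matrix Ω Ω k) v := fun _ => rfl
      have hiF : ∀ v, i (p (F v)) = F v := by
        intro v
        rw [hip, hF, ← permEnd_mul_apply, hef']
      have hFi : ∀ v, F (i (p v)) = F v := by
        intro v
        rw [hip, hF, hF, ← permEnd_mul_apply, hfe']
      have hFF : ∀ v, F (F v) = F v := by
        intro v
        rw [hF, hF, ← permEnd_mul_apply, hf']
      rcases hid (p.comp (F.comp i)) (LinearMap.ext fun m => by
        simp only [LinearMap.comp_apply]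
        rw [hiF, hFF]) with h0 | h1
      · left
        refine Subtype.ext (permEnd_inj (G := G) fun v => ?_)
        rw [← hF, ← hiF, ← hFi]
        have := LinearMap.congr_fun h0 (p v)
        simp only [LinearMap.comp_apply, LinearMap.zero_apply] at this
        rw [this]
        simp
      · right
        refine Subtype.ext (permEnd_inj (G := G) fun v => ?_)
        rw [← hF, ← hiF, ← hFi]
        have := LinearMap.congr_fun h1 (p v)
        simp only [LinearMap.comp_apply, LinearMap.id_apply] at this
        rw [this, hip]
  · rintro ⟨he0, -, hprim⟩
    constructor
    · by_contra hM
      rw [not_nontrivial_iff_subsingleton] at hM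
      refine he0 (Subtype.ext (permEnd_inj (G := G) fun v => ?_))
      rw [← hip, Subsingleton.elim (p v) 0]
      simp
    · intro φ hφ
      have hφ' : ∀ m, φ (φ m) = φ m := LinearMap.congr_fun hφ
      obtain ⟨f, hf, hfv⟩ := (isSubgroupLinear_linearMap (⊤ : Subgroup G)
        (i.comp (φ.comp p))).exists_permEnd
      have hfv' : ∀ v, permEnd G f v = i (φ (p v)) := hfv
      have h1 : f * f = f := permEnd_inj (G := G) fun v => by
        rw [permEnd_mul_apply, hfv', hfv', hpi, hφ']
      have h2 : (e : Matrix Ω Ω k) * f = f := permEnd_inj (G := G) fun v => by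
        rw [permEnd_mul_apply, hfv', ← hip, hpi]
      have h3 : f * (e : Matrix Ω Ω k) = f := permEnd_inj (G := G) fun v => by
        rw [permEnd_mul_apply, hfv', ← hip, hpi, hfv']
      rcases hprim ⟨f, hf⟩ (Subtype.ext h1) (Subtype.ext h2) (Subtype.ext h3) with h0 | h1
      · left
        refine LinearMap.ext fun m => hi ?_
        have h0' : f = 0 := congrArg Subtype.val h0
        have := hfv' (i m)
        rw [hpi, h0'] at this
        rw [← this]
        simp
      · right
        refine LinearMap.ext fun m => hi ?_
        have h1' : f = e := congrArg Subtype.val h1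
        have := hfv' (i m)
        rw [hpi, h1', ← hip, hpi] at this
        rw [← this, LinearMap.id_apply]

theorem IsImageOf.exists_trMap_iff [Finite G] (H : Subgroup G) {e : Matrix Ω Ω k}
    (h : IsImageOf (G := G) M e) :
    (∃ α : M →+ M, IsSubgroupLinear k H α ∧ ∀ m, trMap k H α m = m) ↔
      ∃ a ∈ invMat k Ω H, relTrace H a = e := by
  obtain ⟨i, p, hpi, hip⟩ := h
  constructor
  · rintro ⟨α, hα, hm⟩
    obtain ⟨a, ha, hav⟩ := (hα.comp i p).exists_permEnd
    refine ⟨a, ha, permEnd_inj (G := G) fun v => ?_⟩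
    rw [permEnd_relTrace, ← hip]
    have : (permEnd G a).toAddMonoidHom = (i.toAddMonoidHom.comp α).comp p.toAddMonoidHom :=
      AddMonoidHom.ext hav
    rw [this, trMap_comp, hm]
  · rintro ⟨a, ha, hae⟩
    refine ⟨_, (isSubgroupLinear_permEnd_iff.2 ha).comp p i, fun m => ?_⟩
    rw [trMap_comp, ← permEnd_relTrace, hae, ← hip, hpi, hpi]

end SummandsAndIdempotents

section FixedPointSets

open scoped Classical

section

variable {k G Ω : Type*} [Field k] [Group G] [Finite G] [MulAction G Ω] [Fintype Ω] [DecidableEq Ω]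

theorem relTrace_bot_apply [Fintype G] (a : Matrix Ω Ω k) (x y : Ω) :
    relTrace (⊥ : Subgroup G) a x y = ∑ g : G, a (g⁻¹ • x) (g⁻¹ • y) := by
  rw [relTrace_apply, sum_out_bot fun g => a (g⁻¹ • x) (g⁻¹ • y)]

theorem mem_invMat_bot (a : Matrix Ω Ω k) : a ∈ invMat k Ω (⊥ : Subgroup G) := by
  intro h hh x y
  rw [Subgroup.mem_bot.1 hh, one_smul, one_smul]

/-- An idempotent that is a relative trace from `H` and has a nonzero entry in the block `X × X`
dominates a primitive idempotent with the same properties. -/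
theorem exists_isPrimitiveIdem_relTrace {H : Subgroup G} (X : Set Ω) {e a : Matrix Ω Ω k}
    (he : e ∈ invMat k Ω (⊤ : Subgroup G)) (hee : e * e = e) (ha : a ∈ invMat k Ω H)
    (hae : relTrace H a = e) (hX : ∃ x ∈ X, ∃ y ∈ X, e x y ≠ 0) :
    ∃ e' : invMat k Ω (⊤ : Subgroup G), IsPrimitiveIdem e' ∧
      (∃ x ∈ X, ∃ y ∈ X, (e' : Matrix Ω Ω k) x y ≠ 0) ∧
      ∃ a ∈ invMat k Ω H, relTrace H a = e' := by
  refine exists_isPrimitiveIdem k (fun e' : invMat k Ω (⊤ : Subgroup G) =>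
    (∃ x ∈ X, ∃ y ∈ X, (e' : Matrix Ω Ω k) x y ≠ 0) ∧
      ∃ a ∈ invMat k Ω H, relTrace H a = e') ?_ ?_ ⟨e, he⟩ (Subtype.ext hee) ⟨hX, a, ha, hae⟩
  · rintro ⟨⟨x, -, y, -, h⟩, -⟩
    exact h rfl
  · rintro e f he - hef hfe ⟨⟨x, hx, y, hy, h⟩, a, ha, hae⟩
    have hmem : ∀ g : invMat k Ω (⊤ : Subgroup G), e * g = g →
        ∃ a ∈ invMat k Ω H, relTrace H a = g := fun g hg =>
      ⟨a * g, mul_mem ha (invMat_anti le_top g.2), by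
        rw [relTrace_mul_right g.2, hae]
        exact congrArg Subtype.val hg⟩
    by_cases h0 : (f : Matrix Ω Ω k) x y = 0
    · right
      refine ⟨⟨x, hx, y, hy, ?_⟩, hmem _ (by rw [mul_sub, he, hef])⟩
      rw [AddSubgroupClass.coe_sub, Matrix.sub_apply, h0, sub_zero]
      exact h
    · left
      exact ⟨⟨x, hx, y, hy, h0⟩, hmem _ hef⟩

theorem isPGroup_of_relTrace_minimal {p : ℕ} (hp : p.Prime) [CharP k p] {Q : Subgroup G}
    {e a : Matrix Ω Ω k} (ha : a ∈ invMat k Ω Q) (hae : relTrace Q a = e)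
    (hmin : ∀ Q' ≤ Q, ∀ b ∈ invMat k Ω Q', relTrace Q' b = e → Q' = Q) : IsPGroup p Q := by
  have := Fact.mk hp
  obtain ⟨P⟩ : Nonempty (Sylow p Q) := inferInstance
  have hle : P.toSubgroup.map Q.subtype ≤ Q := Subgroup.map_subtype_le _
  have hindex : (P.toSubgroup.map Q.subtype).relIndex Q = P.toSubgroup.index := by
    rw [Subgroup.relIndex, Subgroup.subgroupOf,
      Subgroup.comap_map_eq_self_of_injective Q.subtype_injective]
  have hne : ((P.toSubgroup.map Q.subtype).relIndex Q : k) ≠ 0 := by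
    rw [hindex, Ne, CharP.cast_eq_zero_iff k p]
    exact P.not_dvd_index
  have h := hmin _ hle (((P.toSubgroup.map Q.subtype).relIndex Q : k)⁻¹ • a)
    (Subalgebra.smul_mem _ (invMat_anti hle ha) _) (by
      rw [relTrace_smul, relTrace_of_le hle ha, smul_smul, inv_mul_cancel₀ hne, one_smul, hae])
  rw [← h]
  exact P.isPGroup'.map _

end

variable {k G Ω : Type} [Field k] [Group G] [Finite G] [MulAction G Ω] [Fintype Ω]
  [DecidableEq Ω] {p : ℕ}
  {X : Set Ω}

theorem IsPrimitiveIdem.exists_isPrimitiveIdem_relTrace_bot (hp : p.Prime) [CharP k p]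
    [Fintype (stabPermHom G X).range] {Q : Subgroup G} {e : invMat k Ω (⊤ : Subgroup G)}
    {a : Matrix Ω Ω k} (he : IsPrimitiveIdem e) (hQ : IsPGroup p Q) (hX : X = FixSet Ω Q)
    (ha : a ∈ invMat k Ω Q) (hae : relTrace Q a = e)
    (hmin : ∀ Q' ≤ Q, ∀ b ∈ invMat k Ω Q', relTrace Q' b = e → Q' = Q) :
    ∃ f : invMat k X (⊤ : Subgroup (stabPermHom G X).range), IsPrimitiveIdem f ∧
      ∃ b ∈ invMat k X (⊥ : Subgroup (stabPermHom G X).range),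
        relTrace (⊥ : Subgroup (stabPermHom G X).range) b = f := by
  obtain ⟨x, y, hxy⟩ := he.exists_apply_ne_zero hp hQ hX ha hae hmin
  let f : Matrix X X k := brauerHom hp hQ hX ⟨e, invMat_anti le_top e.2⟩
  have hff : f * f = f := by
    rw [← map_mul]
    exact congrArg _ (Subtype.ext (congrArg Subtype.val he.2.1 : (e : Matrix Ω Ω k) * e = e))
  have hf : relTrace (⊥ : Subgroup (stabPermHom G X).range)
      (Matrix.of fun x y : X => (Q.relIndex (pointStab G X) : k) * a x y) = f := by
    ext x y
    rw [relTrace_bot_apply]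
    have := relTrace_apply_fixSet hp hQ hX ha x y
    rw [hae, Finset.mul_sum] at this
    exact this.symm
  have hfinv : f ∈ invMat k X (⊤ : Subgroup (stabPermHom G X).range) := by
    rw [← hf]
    exact relTrace_mem (mem_invMat_bot _)
  obtain ⟨f', hf', -, hb⟩ := exists_isPrimitiveIdem_relTrace Set.univ hfinv hff
    (mem_invMat_bot _) hf ⟨x, trivial, y, trivial, hxy⟩
  exact ⟨f', hf', hb⟩

theorem IsFixedPointSet.exists_projective (hp : p.Prime) [CharP k p]
    (h : IsFixedPointSet k G Ω X) :
    ∃ P : ModuleCat.{v} (MonoidAlgebra k (stabPermHom G X).range),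
      IsSummand (MonoidAlgebra k (stabPermHom G X).range) P
        (PermMod k (stabPermHom G X).range X) ∧
      IsIndecomposable (MonoidAlgebra k (stabPermHom G X).range) P ∧
      Module.Projective (MonoidAlgebra k (stabPermHom G X).range) P := by
  cases nonempty_fintype (stabPermHom G X).range
  obtain ⟨M, Q, hsum, hind, ⟨hproj, hmin⟩, hX⟩ := h
  obtain ⟨e, he, hee, him⟩ := hsum.exists_isImageOf
  have hrel : ∀ H, IsRelProjective k M H ↔ ∃ a ∈ invMat k Ω H, relTrace H a = e := fun H =>
    (isRelProjective_iff M H).trans (him.exists_trMap_iff H)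
  obtain ⟨a, ha, hae⟩ := (hrel Q).1 hproj
  have hmin' : ∀ Q' ≤ Q, ∀ b ∈ invMat k Ω Q', relTrace Q' b = e → Q' = Q :=
    fun Q' hQ' b hb hbe => hmin Q' hQ' ((hrel Q').2 ⟨b, hb, hbe⟩)
  have hQ : IsPGroup p Q := isPGroup_of_relTrace_minimal hp ha hae hmin'
  have hprim := (IsImageOf.isIndecomposable_iff (e := ⟨e, he⟩) (Subtype.ext hee) him).1 hind
  obtain ⟨f, hf, hb⟩ := hprim.exists_isPrimitiveIdem_relTrace_bot hp hQ hX ha hae hmin'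
  obtain ⟨P, hP⟩ := exists_isImageOf.{0, v} f.2 (congrArg Subtype.val hf.2.1)
  exact ⟨P, hP.isSummand, (IsImageOf.isIndecomposable_iff hf.2.1 hP).2 hf,
    (projective_iff P).2 ((hP.exists_trMap_iff ⊥).2 hb)⟩

theorem isFixedPointSet_of_exists_projective (hp : p.Prime) [CharP k p]
    (QX : Sylow p (pointStab G X))
    (hclosed : FixSet Ω (QX.toSubgroup.map (pointStab G X).subtype) = X)
    (P : ModuleCat.{v} (MonoidAlgebra k (stabPermHom G X).range))
    (hsum : IsSummand (MonoidAlgebra k (stabPermHom G X).range) P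
      (PermMod k (stabPermHom G X).range X))
    (hind : IsIndecomposable (MonoidAlgebra k (stabPermHom G X).range) P)
    (hproj : Module.Projective (MonoidAlgebra k (stabPermHom G X).range) P) :
    IsFixedPointSet k G Ω X := by
  have := Fact.mk hp
  cases nonempty_fintype (stabPermHom G X).range
  obtain ⟨f, hf, hff, him⟩ := hsum.exists_isImageOf
  obtain ⟨b, -, hbf⟩ := (him.exists_trMap_iff ⊥).1 ((projective_iff P).1 hproj)
  have hf0 : f ≠ 0 := by
    intro h
    have hprim := (IsImageOf.isIndecomposable_iff (e := ⟨f, hf⟩) (Subtype.ext hff) him).1 hind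
    exact hprim.1 (Subtype.ext h)
  set Q := QX.toSubgroup.map (pointStab G X).subtype with hQdef
  have hX : X = FixSet Ω Q := hclosed.symm
  have hQ : IsPGroup p Q := QX.isPGroup'.map _
  have hm : (Q.relIndex (pointStab G X) : k) ≠ 0 := by
    rw [hQdef, Subgroup.relIndex, Subgroup.subgroupOf,
      Subgroup.comap_map_eq_self_of_injective (pointStab G X).subtype_injective, Ne,
      CharP.cast_eq_zero_iff k p]
    exact QX.not_dvd_index
  let B : Matrix Ω Ω k := Matrix.of fun x y =>
    if h : x ∈ X ∧ y ∈ X then (Q.relIndex (pointStab G X) : k)⁻¹ * b ⟨x, h.1⟩ ⟨y, h.2⟩ else 0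
  have hBX : ∀ x y : X, B x y = (Q.relIndex (pointStab G X) : k)⁻¹ * b x y := fun x y =>
    dif_pos ⟨x.2, y.2⟩
  have hB0 : ∀ x y, ¬ (x ∈ X ∧ y ∈ X) → B x y = 0 := fun x y h => dif_neg h
  have hB : B ∈ invMat k Ω Q := by
    intro g hg x y
    by_cases h : x ∈ X ∧ y ∈ X
    · have hfix : ∀ z ∈ X, g • z = z := fun z hz => by
        rw [hX] at hz
        exact hz g hg
      rw [hfix x h.1, hfix y h.2]
    · rw [hB0 x y h, hB0]
      rwa [smul_mem_fixSet_iff hX hg, smul_mem_fixSet_iff hX hg]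
  let c : invMat k Ω (⊤ : Subgroup G) := ⟨relTrace Q B, relTrace_mem hB⟩
  let br : invMat k Ω (⊤ : Subgroup G) →ₐ[k] Matrix X X k :=
    (brauerHom hp hQ hX).comp (Subalgebra.inclusion (invMat_anti le_top))
  have hbr : ∀ (d : invMat k Ω (⊤ : Subgroup G)) (x y : X),
      br d x y = (d : Matrix Ω Ω k) x y := fun _ _ _ => rfl
  have hcf : br c = f := by
    ext x y
    rw [hbr, ← hbf, relTrace_bot_apply]
    refine (relTrace_apply_fixSet hp hQ hX hB x y).trans ?_
    simp only [hBX]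
    rw [← Finset.mul_sum, ← mul_assoc, mul_inv_cancel₀ hm, one_mul]
  obtain ⟨q, hidem, n, hnil⟩ := exists_polynomial_idempotent k c
  set e := c * Polynomial.aeval c q with he
  have hbre : br e ≠ 0 := by
    intro h0
    have := congrArg br hnil
    rw [map_pow, map_mul, map_sub, h0, map_one, sub_zero, mul_one, map_zero, hcf] at this
    have hpow : ∀ n : ℕ, f ^ (n + 1) = f := fun n => IsIdempotentElem.pow_succ_eq n hff
    apply hf0
    rw [← hpow n, pow_succ, this, zero_mul]
  have hexy : ∃ x ∈ X, ∃ y ∈ X, (e : Matrix Ω Ω k) x y ≠ 0 := by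
    by_contra! h
    exact hbre (Matrix.ext fun x y => h x x.2 y y.2)
  obtain ⟨e', he', ⟨x, hx, y, hy, hxy⟩, a, ha, hae⟩ := exists_isPrimitiveIdem_relTrace X e.2
    (congrArg Subtype.val hidem)
    (mul_mem hB (invMat_anti le_top (Polynomial.aeval c q).2))
    (relTrace_mul_right (Polynomial.aeval c q).2 B) hexy
  obtain ⟨M, hM⟩ := exists_isImageOf.{0, 0} e'.2 (congrArg Subtype.val he'.2.1)
  have hrel : ∀ H, IsRelProjective k M H ↔ ∃ a ∈ invMat k Ω H, relTrace H a = e' := fun H =>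
    (isRelProjective_iff M H).trans (hM.exists_trMap_iff H)
  refine ⟨M, Q, hM.isSummand, (IsImageOf.isIndecomposable_iff he'.2.1 hM).2 he',
    ⟨(hrel Q).2 ⟨a, ha, hae⟩, fun Q' hQ' hrel' => ?_⟩, hX⟩
  obtain ⟨a', ha', hae'⟩ := (hrel Q').1 hrel'
  by_contra hne
  rw [hX] at hx hy
  apply hxy
  rw [← hae']
  exact relTrace_apply_eq_zero hp hQ (lt_of_le_of_ne hQ' hne) ha' hx hy

end FixedPointSets

/-- **Broué-type criterion** ([tp05, 2.12]).  Let `G` be a finite group, `Ω` a finite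
`G`-set, `k` a field of characteristic `p`, and `X ⊆ Ω` a closed subset (i.e.
`Fix_Ω(Q_X) = X` for `Q_X` a Sylow `p`-subgroup of the pointwise stabilizer `S_X`).
Then `X` is a fixed point set of `kΩ` if and only if `kX`, as a permutation module for
`N̄_X = N_X/S_X`, has a projective indecomposable direct summand. -/
theorem closed_subset_is_fixed_point_set_iff (k G Ω : Type) [Field k] [Group G]
    [Fintype G] [MulAction G Ω] [Fintype Ω] (p : ℕ) (hp : p.Prime) [CharP k p]
    (X : Set Ω)
    (hclosed : ∀ QX : Sylow p ↥(pointStab G X),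
      FixSet Ω (Subgroup.map (pointStab G X).subtype QX.toSubgroup) = X) :
    IsFixedPointSet k G Ω X ↔
      ∃ P : ModuleCat (MonoidAlgebra k ↥(stabPermHom G X).range),
        IsSummand (MonoidAlgebra k ↥(stabPermHom G X).range) P
          (PermMod k ↥(stabPermHom G X).range ↥X) ∧
        IsIndecomposable (MonoidAlgebra k ↥(stabPermHom G X).range) P ∧
        Module.Projective (MonoidAlgebra k ↥(stabPermHom G X).range) P := by
  classical
  constructor
  · exact fun h => IsFixedPointSet.exists_projective hp h
  · rintro ⟨P, hsum, hind, hproj⟩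
    obtain ⟨QX⟩ : Nonempty (Sylow p (pointStab G X)) := inferInstance
    exact isFixedPointSet_of_exists_projective hp QX (hclosed QX) P hsum hind hproj

end PPaper
end
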